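/- Let ξ > 0, let α be a non-negative integer, and suppose √T ≤ H ≤ T/log T. Define I(ξ, α) := ∫_T^{T+H} (t/(eξ))^{it} dt/(log τ)^α, where τ = √(t/(2π)). Then: if T ≤ ξ ≤ T+H, I(ξ,α) = 2^α e^{πi/4} √(2πξ) e^{−iξ} (log(ξ/(2π)))^{−α} + O( R(ξ) (log T)^{−α} ); and if ξ ≤ T or ξ ≥ T+H, I(ξ,α) = O( (log T)^{−α} R(ξ) ), where R(ξ) = O(1) + O( T/(|T−ξ| + √T) ) + O( (T+H)/(|T+H−ξ| + √(T+H)) ). -/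

import Mathlib

open Filter

theorem aux_ibp {a b : ℝ} (hab : a ≤ b) {φ p q q' D : ℝ → ℝ}
    (hφ : ∀ t ∈ Set.Icc a b, HasDerivAt φ (p t) t)
    (hq : ∀ t ∈ Set.Icc a b, HasDerivAt q (q' t) t)
    (hp : ContinuousOn p (Set.Icc a b)) (hq' : ContinuousOn q' (Set.Icc a b))
    (hD : ContinuousOn D (Set.Icc a b)) (hb : ∀ t ∈ Set.Icc a b, |q' t| ≤ D t) :
    ‖∫ t in a..b, Complex.exp (Complex.I * (φ t : ℂ)) * ((p t * q t : ℝ) : ℂ)‖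
      ≤ |q a| + |q b| + ∫ t in a..b, D t := by
  have hu : Set.uIcc a b = Set.Icc a b := Set.uIcc_of_le hab
  have hφc : ContinuousOn φ (Set.Icc a b) := fun t ht => (hφ t ht).continuousAt.continuousWithinAt
  have hqc : ContinuousOn q (Set.Icc a b) := fun t ht => (hq t ht).continuousAt.continuousWithinAt
  have hec : ContinuousOn (fun t => Complex.exp (Complex.I * (φ t : ℂ))) (Set.Icc a b) := by
    fun_prop
  have h1 : ContinuousOn (fun t => Complex.exp (Complex.I * (φ t : ℂ)) * ((p t * q t : ℝ) : ℂ))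
      (Set.Icc a b) := by fun_prop
  have h2 : ContinuousOn (fun t => Complex.exp (Complex.I * (φ t : ℂ)) * (-Complex.I * (q' t : ℂ)))
      (Set.Icc a b) := by fun_prop
  have i1 : IntervalIntegrable _ MeasureTheory.volume a b := (hu ▸ h1).intervalIntegrable
  have i2 : IntervalIntegrable _ MeasureTheory.volume a b := (hu ▸ h2).intervalIntegrable
  have key := intervalIntegral.integral_eq_sub_of_hasDerivAt (a := a) (b := b)
    (f := fun t => Complex.exp (Complex.I * (φ t : ℂ)) * (-Complex.I * (q t : ℂ)))
    (f' := fun t => Complex.exp (Complex.I * (φ t : ℂ)) * ((p t * q t : ℝ) : ℂ) +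
      Complex.exp (Complex.I * (φ t : ℂ)) * (-Complex.I * (q' t : ℂ))) (by
      intro t ht
      rw [hu] at ht
      have e := (((hφ t ht).ofReal_comp.const_mul Complex.I).cexp).mul
        ((hq t ht).ofReal_comp.const_mul (-Complex.I))
      refine e.congr_deriv ?_
      push_cast
      linear_combination (-Complex.exp (Complex.I * (φ t : ℂ)) * (p t * q t)) * Complex.I_sq) (i1.add i2)
  rw [intervalIntegral.integral_add i1 i2] at key
  have hn : ∀ x : ℝ, ‖Complex.exp (Complex.I * (x : ℂ))‖ = 1 := fun x => by
    rw [mul_comm]; exact Complex.norm_exp_ofReal_mul_I x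
  have e2 : ‖∫ t in a..b, Complex.exp (Complex.I * (φ t : ℂ)) * (-Complex.I * (q' t : ℂ))‖
      ≤ ∫ t in a..b, D t := by
    apply intervalIntegral.norm_integral_le_of_norm_le hab
    · refine Eventually.of_forall fun t ht => ?_
      rw [norm_mul, hn]
      simpa using hb t (Set.Ioc_subset_Icc_self ht)
    · exact (hu ▸ hD).intervalIntegrable
  rw [eq_sub_of_add_eq key]
  refine (norm_sub_le _ _).trans (add_le_add ((norm_sub_le _ _).trans ?_) e2)
  simp only [norm_mul, hn]
  simp [add_comm]

theorem aux_fd {a b ξ δ W : ℝ} (ha : 0 < a) (hab : a ≤ b) (hb2 : b ≤ 2 * a) (hξ : 0 < ξ)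
    (hδ : 0 < δ) (hL : ∀ t ∈ Set.Icc a b, δ ≤ |Real.log (t / ξ)|) {w w' : ℝ → ℝ}
    (hw : ∀ t ∈ Set.Icc a b, HasDerivAt w (w' t) t) (hw' : ContinuousOn w' (Set.Icc a b))
    (hW : ∀ t ∈ Set.Icc a b, |w t| ≤ W) (hW' : ∀ t ∈ Set.Icc a b, |t * w' t| ≤ W) :
    ‖∫ t in a..b, Complex.exp (Complex.I * ((t * (Real.log (t / ξ) - 1) : ℝ) : ℂ)) * (w t : ℂ)‖
      ≤ 5 * W / δ := by
  have hu : Set.uIcc a b = Set.Icc a b := Set.uIcc_of_le hab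
  have hpos : ∀ t ∈ Set.Icc a b, 0 < t := fun t ht => ha.trans_le ht.1
  have hL0 : ∀ t ∈ Set.Icc a b, Real.log (t / ξ) ≠ 0 := fun t ht h => by
    have := hL t ht
    rw [h, abs_zero] at this; linarith
  have hlogd : ∀ t ∈ Set.Icc a b, HasDerivAt (fun t => Real.log (t / ξ)) (1 / t) t := fun t ht => by
    have h0 := hpos t ht
    have := ((hasDerivAt_id t).div_const ξ).log (by simp [h0.ne', hξ.ne'])
    refine this.congr_deriv ?_
    simp only [id]; field_simp
  have hlogc : ContinuousOn (fun t => Real.log (t / ξ)) (Set.Icc a b) :=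
    fun t ht => (hlogd t ht).continuousAt.continuousWithinAt
  have hwc : ContinuousOn w (Set.Icc a b) := fun t ht => (hw t ht).continuousAt.continuousWithinAt
  have hW0 : 0 ≤ W := (abs_nonneg _).trans (hW a ⟨le_rfl, hab⟩)
  have hic : ContinuousOn (fun t : ℝ => 1 / t) (Set.Icc a b) :=
    continuousOn_const.div continuousOn_id (fun t ht => (hpos t ht).ne')
  have hdc : ContinuousOn (fun t => (1 / t) / (Real.log (t / ξ)) ^ 2) (Set.Icc a b) :=
    hic.div (hlogc.pow 2) (fun t ht => pow_ne_zero 2 (hL0 t ht))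
  have main := aux_ibp hab (φ := fun t => t * (Real.log (t / ξ) - 1))
    (p := fun t => Real.log (t / ξ)) (q := fun t => w t / Real.log (t / ξ))
    (q' := fun t => (w' t * Real.log (t / ξ) - w t * (1 / t)) / (Real.log (t / ξ)) ^ 2)
    (D := fun t => W / a / δ + W * ((1 / t) / (Real.log (t / ξ)) ^ 2))
    (fun t ht => by
      have h0 := hpos t ht
      have := (hasDerivAt_id t).mul ((hlogd t ht).sub_const 1)
      refine this.congr_deriv ?_
      simp only [id]; field_simp; ring)
    (fun t ht => (hw t ht).div (hlogd t ht) (hL0 t ht))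
    hlogc
    (((hw'.mul hlogc).sub (hwc.mul hic)).div (hlogc.pow 2) (fun t ht => pow_ne_zero 2 (hL0 t ht)))
    (continuousOn_const.add (continuousOn_const.mul hdc))
    (fun t ht => by
      have h0 := hpos t ht
      have hl := hL0 t ht
      have hw1 : |w' t| ≤ W / a := by
        have := hW' t ht
        rw [abs_mul, abs_of_pos h0] at this
        rw [le_div_iff₀ ha]
        nlinarith [ht.1, abs_nonneg (w' t)]
      have e : (w' t * Real.log (t / ξ) - w t * (1 / t)) / (Real.log (t / ξ)) ^ 2
        = w' t / Real.log (t / ξ) - w t * ((1 / t) / (Real.log (t / ξ)) ^ 2) := by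
        field_simp
      rw [e]
      refine (abs_sub _ _).trans (add_le_add ?_ ?_)
      · rw [abs_div]
        exact div_le_div₀ (by positivity) hw1 hδ (hL t ht)
      · rw [abs_mul, abs_of_nonneg (a := (1 / t) / (Real.log (t / ξ)) ^ 2) (by positivity)]
        exact mul_le_mul_of_nonneg_right (hW t ht) (by positivity))
  have hI : ∫ t in a..b, (1 / t) / (Real.log (t / ξ)) ^ 2
      = - (Real.log (b / ξ))⁻¹ - - (Real.log (a / ξ))⁻¹ := by
    refine intervalIntegral.integral_eq_sub_of_hasDerivAt
      (f := fun t => - (Real.log (t / ξ))⁻¹) ?_ (hu ▸ hdc).intervalIntegrable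
    intro t ht
    rw [hu] at ht
    refine ((hlogd t ht).inv (hL0 t ht)).neg.congr_deriv ?_
    ring
  have hinv : ∀ t ∈ Set.Icc a b, |(Real.log (t / ξ))⁻¹| ≤ 1 / δ := fun t ht => by
    rw [abs_inv, ← one_div]
    exact one_div_le_one_div_of_le hδ (hL t ht)
  have hq : ∀ t ∈ Set.Icc a b, |w t / Real.log (t / ξ)| ≤ W / δ := fun t ht => by
    rw [abs_div]
    exact div_le_div₀ hW0 (hW t ht) hδ (hL t ht)
  have ma : a ∈ Set.Icc a b := ⟨le_rfl, hab⟩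
  have mb : b ∈ Set.Icc a b := ⟨hab, le_rfl⟩
  rw [intervalIntegral.integral_add (by simp) ((hu ▸ hdc).intervalIntegrable.const_mul W),
    intervalIntegral.integral_const_mul, hI, intervalIntegral.integral_const] at main
  have e1 : (b - a) • (W / a / δ) ≤ W / δ := by
    have : (b - a) / a ≤ 1 := by rw [div_le_one ha]; linarith
    have h2 : (b - a) • (W / a / δ) = ((b - a) / a) * (W / δ) := by
      simp; field_simp
    rw [h2]
    have : 0 ≤ W / δ := by positivity
    nlinarith
  have e2 : W * (- (Real.log (b / ξ))⁻¹ - - (Real.log (a / ξ))⁻¹) ≤ 2 * (W / δ) := by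
    have h1 := abs_le.1 (hinv a ma)
    have h2 := abs_le.1 (hinv b mb)
    have : W * (- (Real.log (b / ξ))⁻¹ - - (Real.log (a / ξ))⁻¹) ≤ W * (2 * (1 / δ)) :=
      mul_le_mul_of_nonneg_left (by linarith) hW0
    refine this.trans (le_of_eq (by ring))
  have hc : ∫ t in a..b, Complex.exp (Complex.I * ((t * (Real.log (t / ξ) - 1) : ℝ) : ℂ)) * (w t : ℂ)
     = ∫ t in a..b, Complex.exp (Complex.I * ((t * (Real.log (t / ξ) - 1) : ℝ) : ℂ)) *
        ((Real.log (t / ξ) * (w t / Real.log (t / ξ)) : ℝ) : ℂ) := by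
    apply intervalIntegral.integral_congr
    intro t ht
    rw [hu] at ht
    simp only
    rw [mul_div_cancel₀ _ (hL0 t ht)]
  rw [hc]
  have := hq a ma
  have := hq b mb
  have h5 : 5 * W / δ = 5 * (W / δ) := by ring
  rw [h5]
  refine main.trans ?_
  linarith

theorem aux_gauss_tail {b : ℂ} (hb : 0 < b.re) (hb2 : 1 / 2 ≤ ‖b‖) {S : ℝ} (hS : 0 < S) :
    ‖(∫ s in (0:ℝ)..S, Complex.exp (-b * (s : ℂ) ^ 2)) - ((Real.pi : ℂ) / b) ^ (1 / 2 : ℂ) / 2‖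
      ≤ 2 / S := by
  have hb0 : b ≠ 0 := fun h => by simp [h] at hb
  have hcont : Continuous (fun s : ℝ => Complex.exp (-b * (s : ℂ) ^ 2)) := by fun_prop
  have hlim := MeasureTheory.intervalIntegral_tendsto_integral_Ioi (0:ℝ)
    (integrable_cexp_neg_mul_sq hb).integrableOn tendsto_id
  rw [integral_gaussian_complex_Ioi hb] at hlim
  have hle : ∀ᶠ X : ℝ in atTop, ‖(∫ s in (0:ℝ)..S, Complex.exp (-b * (s : ℂ) ^ 2))
      - ∫ s in (0:ℝ)..X, Complex.exp (-b * (s : ℂ) ^ 2)‖ ≤ 2 / S := by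
    filter_upwards [eventually_ge_atTop S] with X hX
    have hu : Set.uIcc S X = Set.Icc S X := Set.uIcc_of_le hX
    rw [intervalIntegral.integral_interval_sub_left (hcont.intervalIntegrable _ _)
      (hcont.intervalIntegrable _ _), intervalIntegral.integral_symm, norm_neg]
    have hpos : ∀ s ∈ Set.Icc S X, 0 < s := fun s hs => hS.trans_le hs.1
    have hne : ∀ s ∈ Set.Icc S X, (s : ℂ) ≠ 0 := fun s hs => by exact_mod_cast (hpos s hs).ne'
    have h2 : ContinuousOn (fun s : ℝ => Complex.exp (-b * (s : ℂ) ^ 2) * ((2 * b)⁻¹ * ((s : ℂ) ^ 2)⁻¹))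
        (Set.Icc S X) := by
      apply hcont.continuousOn.mul
      apply continuousOn_const.mul
      apply ContinuousOn.inv₀ (by fun_prop)
      intro s hs
      exact pow_ne_zero 2 (hne s hs)
    have i1 := hcont.intervalIntegrable (μ := MeasureTheory.volume) S X
    have i2 : IntervalIntegrable _ MeasureTheory.volume S X := (hu ▸ h2).intervalIntegrable
    have key := intervalIntegral.integral_eq_sub_of_hasDerivAt (a := S) (b := X)
      (f := fun s : ℝ => Complex.exp (-b * (s : ℂ) ^ 2) * (-(2 * b)⁻¹ * ((s : ℂ))⁻¹))
      (f' := fun s : ℝ => Complex.exp (-b * (s : ℂ) ^ 2) +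
        Complex.exp (-b * (s : ℂ) ^ 2) * ((2 * b)⁻¹ * ((s : ℂ) ^ 2)⁻¹)) (by
        intro s hs
        rw [hu] at hs
        have h0 := hne s hs
        have hid : HasDerivAt (fun s : ℝ => (s : ℂ)) 1 s := Complex.ofRealCLM.hasDerivAt
        have e := ((((hid.pow 2).const_mul (-b)).cexp)).mul ((hid.inv h0).const_mul (-(2 * b)⁻¹))
        refine e.congr_deriv ?_
        simp only [Pi.inv_apply, Pi.pow_apply]
        field_simp
        push_cast
        ring) (i1.add i2)
    rw [intervalIntegral.integral_add i1 i2] at key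
    have hn : ∀ s : ℝ, ‖Complex.exp (-b * (s : ℂ) ^ 2)‖ ≤ 1 := fun s => by
      rw [Complex.norm_exp, Real.exp_le_one_iff]
      have : (-b * (s : ℂ) ^ 2).re = - (b.re * s ^ 2) := by
        rw [← Complex.ofReal_pow, Complex.re_mul_ofReal]; simp
      rw [this]
      have : 0 ≤ b.re * s ^ 2 := by positivity
      linarith
    have hbi : ‖(2 * b)⁻¹‖ ≤ 1 := by
      rw [norm_inv, norm_mul]
      apply inv_le_one_of_one_le₀
      simp; linarith
    have bd : ∀ s ∈ Set.Icc S X, ‖Complex.exp (-b * (s : ℂ) ^ 2) * (-(2 * b)⁻¹ * ((s : ℂ))⁻¹)‖ ≤ s⁻¹ := by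
      intro s hs
      rw [norm_mul, norm_mul, norm_neg]
      have h1 := hn s
      have : ‖((s:ℂ))⁻¹‖ = s⁻¹ := by rw [norm_inv, Complex.norm_real, Real.norm_of_nonneg (hpos s hs).le]
      rw [this]
      have h3 : 0 < s⁻¹ := inv_pos.2 (hpos s hs)
      calc _ ≤ 1 * (1 * s⁻¹) := by gcongr
        _ = _ := by ring
    have hic : ContinuousOn (fun s : ℝ => (s ^ 2)⁻¹) (Set.Icc S X) :=
      ContinuousOn.inv₀ (by fun_prop) (fun s hs => pow_ne_zero 2 (hpos s hs).ne')
    have hI : ∫ s in S..X, (s ^ 2)⁻¹ = - X⁻¹ - - S⁻¹ := by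
      refine intervalIntegral.integral_eq_sub_of_hasDerivAt
        (f := fun s => - s⁻¹) ?_ (hu ▸ hic).intervalIntegrable
      intro t ht
      rw [hu] at ht
      refine (hasDerivAt_inv (hpos t ht).ne').neg.congr_deriv ?_
      ring
    have e2 : ‖∫ s in S..X, Complex.exp (-b * (s : ℂ) ^ 2) * ((2 * b)⁻¹ * ((s : ℂ) ^ 2)⁻¹)‖
        ≤ ∫ s in S..X, (s ^ 2)⁻¹ := by
      apply intervalIntegral.norm_integral_le_of_norm_le hX
      · refine Eventually.of_forall fun s hs => ?_
        rw [norm_mul, norm_mul]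
        have h1 := hn s
        have : ‖((s:ℂ) ^ 2)⁻¹‖ = (s ^ 2)⁻¹ := by
          rw [norm_inv, norm_pow, Complex.norm_real]; simp
        rw [this]
        calc _ ≤ 1 * (1 * (s ^ 2)⁻¹) := by gcongr
          _ = _ := by ring
      · exact (hu ▸ hic).intervalIntegrable
    rw [eq_sub_of_add_eq key]
    have b1 := bd S ⟨le_rfl, hX⟩
    have b2 := bd X ⟨hX, le_rfl⟩
    rw [hI] at e2
    refine (norm_sub_le _ _).trans ?_
    have := norm_sub_le (Complex.exp (-b * (X : ℂ) ^ 2) * (-(2 * b)⁻¹ * ((X : ℂ))⁻¹))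
      (Complex.exp (-b * (S : ℂ) ^ 2) * (-(2 * b)⁻¹ * ((S : ℂ))⁻¹))
    have h2S : 2 / S = 2 * S⁻¹ := by ring
    rw [h2S]
    linarith
  exact le_of_tendsto ((tendsto_const_nhds.sub hlim).norm) hle

/-- The half Fresnel integral. -/
noncomputable def auxF : ℂ := (Real.sqrt (2 * Real.pi) : ℂ) * Complex.exp ((Real.pi : ℂ) * Complex.I / 4) / 2

theorem auxF_norm : ‖auxF‖ ≤ 2 := by
  have h : ‖Complex.exp ((Real.pi : ℂ) * Complex.I / 4)‖ = 1 := by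
    have : (Real.pi : ℂ) * Complex.I / 4 = ((Real.pi / 4 : ℝ) : ℂ) * Complex.I := by push_cast; ring
    rw [this, Complex.norm_exp_ofReal_mul_I]
  rw [auxF, norm_div, norm_mul, h, Complex.norm_real, Real.norm_of_nonneg (Real.sqrt_nonneg _)]
  have : Real.sqrt (2 * Real.pi) ≤ 4 := by
    rw [Real.sqrt_le_left (by norm_num)]
    linarith [Real.pi_lt_four]
  rw [Complex.norm_ofNat]; linarith

theorem aux_fresnel {S : ℝ} (hS : 0 < S) :
    ‖(∫ s in (0:ℝ)..S, Complex.exp (Complex.I * ((s ^ 2 / 2 : ℝ) : ℂ))) - auxF‖ ≤ 2 / S := by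
  have hpi := Real.pi_pos
  have hF : auxF = ((Real.pi : ℂ) / (-Complex.I / 2)) ^ (1 / 2 : ℂ) / 2 := by
    have e : (Real.pi : ℂ) / (-Complex.I / 2) = ((2 * Real.pi : ℝ) : ℂ) * Complex.I := by
      have := Complex.I_ne_zero
      field_simp
      push_cast
      linear_combination (-2 * (Real.pi:ℂ)) * Complex.I_sq
    have h2 : (0:ℝ) < 2 * Real.pi := by positivity
    have hs : ((Real.sqrt (2 * Real.pi) : ℝ) : ℂ) = Complex.exp ((Real.log (2 * Real.pi) : ℂ) * (1 / 2)) := by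
      rw [Real.sqrt_eq_rpow, Real.rpow_def_of_pos h2]
      push_cast
      rfl
    rw [e, auxF, hs, Complex.cpow_def_of_ne_zero (by
      apply mul_ne_zero _ Complex.I_ne_zero
      exact_mod_cast h2.ne'), Complex.log_ofReal_mul h2 Complex.I_ne_zero, Complex.log_I,
      ← Complex.exp_add]
    congr 2
    ring
  have hT : Tendsto (fun δ : ℝ => ((δ : ℂ) - Complex.I / 2)) (nhdsWithin 0 (Set.Ioi 0)) (nhds (-Complex.I / 2)) := by
    have : Continuous (fun δ : ℝ => ((δ : ℂ) - Complex.I / 2)) := by fun_prop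
    have := (this.tendsto 0).mono_left (nhdsWithin_le_nhds (s := Set.Ioi 0))
    convert this using 2
    push_cast; ring
  have hlim1 : Tendsto (fun δ : ℝ => ∫ s in (0:ℝ)..S, Complex.exp (-((δ : ℂ) - Complex.I / 2) * (s : ℂ) ^ 2))
      (nhdsWithin 0 (Set.Ioi 0)) (nhds (∫ s in (0:ℝ)..S, Complex.exp (Complex.I * ((s ^ 2 / 2 : ℝ) : ℂ)))) := by
    have hc : Continuous (fun δ : ℝ => ∫ s in (0:ℝ)..S, Complex.exp (-((δ : ℂ) - Complex.I / 2) * (s : ℂ) ^ 2)) := by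
      apply intervalIntegral.continuous_parametric_intervalIntegral_of_continuous'
      fun_prop
    have := (hc.tendsto 0).mono_left (nhdsWithin_le_nhds (s := Set.Ioi 0))
    have e : (∫ s in (0:ℝ)..S, Complex.exp (Complex.I * ((s ^ 2 / 2 : ℝ) : ℂ)))
        = ∫ s in (0:ℝ)..S, Complex.exp (-(((0:ℝ) : ℂ) - Complex.I / 2) * (s : ℂ) ^ 2) := by
      congr 1
      ext s
      congr 1
      push_cast; ring
    rw [e]
    exact this
  have hlim2 : Tendsto (fun δ : ℝ => ((Real.pi : ℂ) / ((δ : ℂ) - Complex.I / 2)) ^ (1 / 2 : ℂ) / 2)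
      (nhdsWithin 0 (Set.Ioi 0)) (nhds auxF) := by
    rw [hF]
    refine Tendsto.div_const ?_ _
    refine Tendsto.cpow (Tendsto.div tendsto_const_nhds hT (by simp)) tendsto_const_nhds ?_
    right
    simp [Complex.div_im, hpi.ne']
  refine le_of_tendsto ((hlim1.sub hlim2).norm) ?_
  filter_upwards [self_mem_nhdsWithin] with δ hδ
  refine aux_gauss_tail (by simpa using hδ) ?_ hS
  have := Complex.abs_im_le_norm ((δ : ℂ) - Complex.I / 2)
  simp at this
  norm_num at this ⊢
  exact this
theorem aux_alg {v σ L g : ℝ} (hv : 0 < v) (hv2 : v ≤ 1 / 2) (hL : |L - v| ≤ v ^ 2)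
    (hσ : |σ - v| ≤ v ^ 2) (hg : |g - 1| ≤ 2 * v) :
    |L / σ ^ 3 - g / L ^ 2| ≤ 544 / v ∧ |1 / L - 1 / σ| ≤ 8 ∧ v / 2 ≤ L ∧ v / 2 ≤ σ ∧ |g| ≤ 2 := by
  have hvv : v ^ 2 ≤ v / 2 := by nlinarith
  have hL1 := abs_le.1 hL
  have hσ1 := abs_le.1 hσ
  have hLl : v / 2 ≤ L := by linarith
  have hσl : v / 2 ≤ σ := by linarith
  have hLu : L ≤ 3 / 2 * v := by linarith
  have hσu : σ ≤ 3 / 2 * v := by linarith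
  have hL0 : 0 < L := by linarith
  have hσ0 : 0 < σ := by linarith
  have cube : ∀ x : ℝ, |x - v| ≤ v ^ 2 → 0 < x → x ≤ 3 / 2 * v → |x ^ 3 - v ^ 3| ≤ 5 * v ^ 4 := by
    intro x hx hx0 hxu
    have e : x ^ 3 - v ^ 3 = (x - v) * (x ^ 2 + x * v + v ^ 2) := by ring
    rw [e, abs_mul, abs_of_pos (a := x ^ 2 + x * v + v ^ 2) (by positivity)]
    have : x ^ 2 + x * v + v ^ 2 ≤ 5 * v ^ 2 := by nlinarith
    calc _ ≤ v ^ 2 * (5 * v ^ 2) := mul_le_mul hx this (by positivity) (by positivity)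
      _ = _ := by ring
  have c1 := cube L hL hL0 hLu
  have c2 := cube σ hσ hσ0 hσu
  have hσ3 : σ ^ 3 ≤ 27 / 8 * v ^ 3 := by
    calc σ ^ 3 ≤ (3 / 2 * v) ^ 3 := by gcongr
      _ = _ := by ring
  refine ⟨?_, ?_, hLl, hσl, ?_⟩
  · have e : L / σ ^ 3 - g / L ^ 2 = ((L ^ 3 - v ^ 3) - (σ ^ 3 - v ^ 3) - (g - 1) * σ ^ 3) / (σ ^ 3 * L ^ 2) := by
      field_simp; ring
    have hden : v ^ 5 / 32 ≤ σ ^ 3 * L ^ 2 := by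
      calc v ^ 5 / 32 = (v / 2) ^ 3 * (v / 2) ^ 2 := by ring
        _ ≤ _ := by gcongr
    have hnum : |(L ^ 3 - v ^ 3) - (σ ^ 3 - v ^ 3) - (g - 1) * σ ^ 3| ≤ 17 * v ^ 4 := by
      have h3 : |(g - 1) * σ ^ 3| ≤ 7 * v ^ 4 := by
        rw [abs_mul, abs_of_pos (a := σ ^ 3) (by positivity)]
        calc _ ≤ (2 * v) * (27 / 8 * v ^ 3) := by gcongr
          _ ≤ _ := by nlinarith [pow_pos hv 4]
      have := abs_sub ((L ^ 3 - v ^ 3) - (σ ^ 3 - v ^ 3)) ((g - 1) * σ ^ 3)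
      have := abs_sub (L ^ 3 - v ^ 3) (σ ^ 3 - v ^ 3)
      linarith
    rw [e, abs_div, abs_of_pos (a := σ ^ 3 * L ^ 2) (by positivity)]
    calc _ ≤ 17 * v ^ 4 / (v ^ 5 / 32) := div_le_div₀ (by positivity) hnum (by positivity) hden
      _ = _ := by field_simp; norm_num
  · have e : 1 / L - 1 / σ = ((σ - v) - (L - v)) / (L * σ) := by field_simp; ring
    have hden : v ^ 2 / 4 ≤ L * σ := by
      calc v ^ 2 / 4 = (v / 2) * (v / 2) := by ring
        _ ≤ _ := by gcongr
    rw [e, abs_div, abs_of_pos (a := L * σ) (by positivity)]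
    have hnum : |(σ - v) - (L - v)| ≤ 2 * v ^ 2 := by
      have := abs_sub (σ - v) (L - v)
      linarith
    calc _ ≤ 2 * v ^ 2 / (v ^ 2 / 4) := div_le_div₀ (by positivity) hnum (by positivity) hden
      _ = _ := by field_simp; norm_num
  · have := abs_le.1 hg
    rw [abs_le]; constructor <;> linarith

theorem aux_sqrt {v G : ℝ} (hv : 0 < v) (hv2 : v ≤ 1 / 2) (hG : |G - v ^ 2 / 2| ≤ v ^ 3 / 3) :
    |Real.sqrt (2 * G) - v| ≤ v ^ 2 ∧ 0 < 2 * G := by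
  have h := abs_le.1 hG
  have h3 : v ^ 3 ≤ v ^ 2 / 2 := by nlinarith [pow_pos hv 2]
  have hp : 0 < 2 * G := by nlinarith [pow_pos hv 2]
  refine ⟨?_, hp⟩
  set σ := Real.sqrt (2 * G)
  have hs : σ ^ 2 = 2 * G := Real.sq_sqrt hp.le
  have hσ : 0 ≤ σ := Real.sqrt_nonneg _
  have e : |σ - v| * (σ + v) ≤ v ^ 3 := by
    rw [← abs_of_nonneg (a := σ + v) (by positivity), ← abs_mul]
    have : (σ - v) * (σ + v) = 2 * (G - v ^ 2 / 2) := by linear_combination hs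
    rw [this, abs_mul, abs_two]
    have := pow_pos hv 3
    linarith
  have e2 : |σ - v| * v ≤ v ^ 2 * v := by
    have := mul_nonneg (abs_nonneg (σ - v)) hσ
    nlinarith
  exact le_of_mul_le_mul_right e2 hv

theorem aux_norm_exp (x : ℝ) : ‖Complex.exp (Complex.I * (x : ℂ))‖ = 1 := by
  rw [mul_comm]; exact Complex.norm_exp_ofReal_mul_I x

/-- outer range -/
theorem aux_outer {N c V W : ℝ} (hN : 0 < N) (hc : 0 < c) (hcV : c ≤ V) (hV : V ≤ 1 / 2)
    {G L G2 w w' : ℝ → ℝ} {w0 : ℝ}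
    (hG : ∀ v ∈ Set.Icc c V, HasDerivAt G (L v) v) (hL : ∀ v ∈ Set.Icc c V, HasDerivAt L (G2 v) v)
    (hG2c : ContinuousOn G2 (Set.Icc c V))
    (bG : ∀ v ∈ Set.Icc c V, |G v - v ^ 2 / 2| ≤ v ^ 3 / 3)
    (bL : ∀ v ∈ Set.Icc c V, |L v - v| ≤ v ^ 2)
    (bG2 : ∀ v ∈ Set.Icc c V, |G2 v - 1| ≤ 2 * v)
    (hw : ∀ v ∈ Set.Icc c V, HasDerivAt w (w' v) v) (hw'c : ContinuousOn w' (Set.Icc c V))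
    (bw' : ∀ v ∈ Set.Icc c V, |w' v| ≤ W)
    (bww : ∀ v ∈ Set.Icc c V, |w v - w0| ≤ W * v) (bw0 : |w0| ≤ W) :
    ‖∫ v in c..V, Complex.exp (Complex.I * ((N * G v : ℝ) : ℂ)) *
      ((w v - w0 * (L v / Real.sqrt (2 * G v)) : ℝ) : ℂ)‖ ≤ W / N * (20 + 562 * Real.log (V / c)) := by
  have hu : Set.uIcc c V = Set.Icc c V := Set.uIcc_of_le hcV
  have hpos : ∀ v ∈ Set.Icc c V, 0 < v := fun v hv => hc.trans_le hv.1
  have hle : ∀ v ∈ Set.Icc c V, v ≤ 1 / 2 := fun v hv => hv.2.trans hV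
  have hW0 : 0 ≤ W := (abs_nonneg _).trans bw0
  have hs := fun v hv => aux_sqrt (hpos v hv) (hle v hv) (bG v hv)
  have ha := fun v hv => aux_alg (hpos v hv) (hle v hv) (bL v hv) (hs v hv).1 (bG2 v hv)
  have hL0 : ∀ v ∈ Set.Icc c V, 0 < L v := fun v hv => by
    have := (ha v hv).2.2.1
    have := hpos v hv
    linarith
  have hσ0 : ∀ v ∈ Set.Icc c V, 0 < Real.sqrt (2 * G v) := fun v hv => Real.sqrt_pos.2 (hs v hv).2
  have hσd : ∀ v ∈ Set.Icc c V, HasDerivAt (fun v => Real.sqrt (2 * G v)) (L v / Real.sqrt (2 * G v)) v := by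
    intro v hv
    refine (((hG v hv).const_mul 2).sqrt (hs v hv).2.ne').congr_deriv ?_
    have := (hσ0 v hv).ne'
    field_simp
  have hLc : ContinuousOn L (Set.Icc c V) := fun t ht => (hL t ht).continuousAt.continuousWithinAt
  have hwc : ContinuousOn w (Set.Icc c V) := fun t ht => (hw t ht).continuousAt.continuousWithinAt
  have hσc : ContinuousOn (fun v => Real.sqrt (2 * G v)) (Set.Icc c V) :=
    fun t ht => (hσd t ht).continuousAt.continuousWithinAt
  have hic : ContinuousOn (fun v : ℝ => 562 * W / N * v⁻¹) (Set.Icc c V) :=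
    continuousOn_const.mul (continuousOn_id.inv₀ (fun v hv => (hpos v hv).ne'))
  have main := aux_ibp hcV (φ := fun v => N * G v) (p := fun v => N * L v)
    (q := fun v => (w v / L v - w0 * (Real.sqrt (2 * G v))⁻¹) / N)
    (q' := fun v => ((w' v * L v - w v * G2 v) / (L v) ^ 2 -
      w0 * (-(L v / Real.sqrt (2 * G v)) / (Real.sqrt (2 * G v)) ^ 2)) / N)
    (D := fun v => 562 * W / N * v⁻¹)
    (fun v hv => (hG v hv).const_mul N)
    (fun v hv => (((hw v hv).div (hL v hv) (hL0 v hv).ne').sub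
      (((hσd v hv).inv (hσ0 v hv).ne').const_mul w0)).div_const N)
    (continuousOn_const.mul hLc)
    ((((((hw'c.mul hLc).sub (hwc.mul hG2c)).div (hLc.pow 2) (fun v hv => pow_ne_zero 2 (hL0 v hv).ne'))).sub
      (continuousOn_const.mul (((hLc.div hσc (fun v hv => (hσ0 v hv).ne')).neg).div (hσc.pow 2)
        (fun v hv => pow_ne_zero 2 (hσ0 v hv).ne')))).div_const N)
    hic
    (fun v hv => by
      have h0 := hpos v hv
      have hl := hL0 v hv
      have hσ := hσ0 v hv
      obtain ⟨a1, a2, a3, a4, a5⟩ := ha v hv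
      have e : ((w' v * L v - w v * G2 v) / (L v) ^ 2 -
        w0 * (-(L v / Real.sqrt (2 * G v)) / (Real.sqrt (2 * G v)) ^ 2)) / N =
        (w' v / L v - (w v - w0) * G2 v / (L v) ^ 2 + w0 * (L v / (Real.sqrt (2 * G v)) ^ 3 - G2 v / L v ^ 2)) / N := by
        field_simp; ring
      have t1 : |w' v / L v| ≤ 2 * W / v := by
        rw [abs_div, abs_of_pos hl]
        calc _ ≤ W / (v / 2) := div_le_div₀ hW0 (bw' v hv) (by positivity) a3
          _ = _ := by field_simp
      have t2 : |(w v - w0) * G2 v / (L v) ^ 2| ≤ 8 * W / v := by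
        rw [abs_div, abs_mul, abs_of_pos (a := L v ^ 2) (by positivity)]
        calc _ ≤ (W * v) * 2 / (v / 2) ^ 2 := by
              apply div_le_div₀ (by positivity) _ (by positivity) (by gcongr)
              exact mul_le_mul (bww v hv) a5 (abs_nonneg _) (by positivity)
          _ = _ := by field_simp; ring
      have t3 : |w0 * (L v / (Real.sqrt (2 * G v)) ^ 3 - G2 v / L v ^ 2)| ≤ 544 * W / v := by
        rw [abs_mul]
        calc _ ≤ W * (544 / v) := mul_le_mul bw0 a1 (abs_nonneg _) hW0
          _ = _ := by ring
      rw [e, abs_div, abs_of_pos hN]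
      have t4 := abs_add_le (w' v / L v - (w v - w0) * G2 v / (L v) ^ 2)
        (w0 * (L v / (Real.sqrt (2 * G v)) ^ 3 - G2 v / L v ^ 2))
      have t5 := abs_sub (w' v / L v) ((w v - w0) * G2 v / (L v) ^ 2)
      have t6 : 2 * W / v + 8 * W / v + 544 * W / v ≤ 562 * W / v := by
        rw [← add_div, ← add_div]
        gcongr
        linarith
      calc _ ≤ (562 * W / v) / N := by gcongr; linarith
        _ = _ := by field_simp)
  have hq : ∀ v ∈ Set.Icc c V, |(w v / L v - w0 * (Real.sqrt (2 * G v))⁻¹) / N| ≤ 10 * W / N := by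
    intro v hv
    have h0 := hpos v hv
    have hl := hL0 v hv
    have hσ := hσ0 v hv
    obtain ⟨a1, a2, a3, a4, a5⟩ := ha v hv
    rw [abs_div, abs_of_pos hN]
    gcongr
    have e : w v / L v - w0 * (Real.sqrt (2 * G v))⁻¹ = (w v - w0) / L v + w0 * (1 / L v - 1 / Real.sqrt (2 * G v)) := by
      field_simp; ring
    rw [e]
    refine (abs_add_le _ _).trans ?_
    have t1 : |(w v - w0) / L v| ≤ 2 * W := by
      rw [abs_div, abs_of_pos hl]
      calc _ ≤ W * v / (v / 2) := div_le_div₀ (by positivity) (bww v hv) (by positivity) a3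
        _ = _ := by field_simp
    have t2 : |w0 * (1 / L v - 1 / Real.sqrt (2 * G v))| ≤ W * 8 := by
      rw [abs_mul]
      exact mul_le_mul bw0 a2 (abs_nonneg _) hW0
    linarith
  have hint : ∫ v in c..V, 562 * W / N * v⁻¹ = 562 * W / N * Real.log (V / c) := by
    rw [intervalIntegral.integral_const_mul, integral_inv_of_pos hc (hc.trans_le hcV)]
  have hcg : ∫ v in c..V, Complex.exp (Complex.I * ((N * G v : ℝ) : ℂ)) *
      ((w v - w0 * (L v / Real.sqrt (2 * G v)) : ℝ) : ℂ) =
      ∫ v in c..V, Complex.exp (Complex.I * ((N * G v : ℝ) : ℂ)) *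
      ((N * L v * ((w v / L v - w0 * (Real.sqrt (2 * G v))⁻¹) / N) : ℝ) : ℂ) := by
    apply intervalIntegral.integral_congr
    intro v hv
    rw [hu] at hv
    have hl := hL0 v hv
    have hσ := hσ0 v hv
    simp only
    congr 2
    field_simp
  rw [hcg]
  refine main.trans ?_
  rw [hint]
  have h1 := hq c ⟨le_rfl, hcV⟩
  have h2 := hq V ⟨hcV, le_rfl⟩
  have : W / N * (20 + 562 * Real.log (V / c)) = 10 * W / N + 10 * W / N + 562 * W / N * Real.log (V / c) := by ring
  rw [this]
  linarith

theorem aux_scale {N x : ℝ} (hN : 0 < N) :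
    ∫ s in (0:ℝ)..x, Complex.exp (Complex.I * ((N * (s ^ 2 / 2) : ℝ) : ℂ)) =
    ((Real.sqrt N)⁻¹ : ℝ) * ∫ s in (0:ℝ)..(Real.sqrt N * x), Complex.exp (Complex.I * ((s ^ 2 / 2 : ℝ) : ℂ)) := by
  have := intervalIntegral.integral_comp_mul_left (a := 0) (b := x)
    (fun s : ℝ => Complex.exp (Complex.I * ((s ^ 2 / 2 : ℝ) : ℂ))) (Real.sqrt_pos.2 hN).ne'
  rw [mul_zero, Complex.real_smul] at this
  rw [← this]
  congr 1
  ext s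
  rw [mul_pow, Real.sq_sqrt hN.le]
  congr 3
  ring

theorem aux_exp_diff (x y : ℝ) :
    ‖Complex.exp (Complex.I * (x : ℂ)) - Complex.exp (Complex.I * (y : ℂ))‖ ≤ |x - y| := by
  have e : Complex.exp (Complex.I * (x : ℂ)) - Complex.exp (Complex.I * (y : ℂ)) =
      Complex.exp (Complex.I * (y : ℂ)) * (Complex.exp (Complex.I * ((x - y : ℝ) : ℂ)) - 1) := by
    rw [mul_sub, ← Complex.exp_add]
    congr 2
    · push_cast; ring
    · ring
  rw [e, norm_mul, aux_norm_exp, one_mul]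
  exact Real.norm_exp_I_mul_ofReal_sub_one_le
theorem aux_side {N V W : ℝ} (hN : 1 ≤ N) (hV0 : 0 ≤ V) (hV : V ≤ 1 / 2)
    {G L G2 w w' : ℝ → ℝ}
    (hG : ∀ v ∈ Set.Icc 0 V, HasDerivAt G (L v) v) (hL : ∀ v ∈ Set.Icc 0 V, HasDerivAt L (G2 v) v)
    (hG2c : ContinuousOn G2 (Set.Icc 0 V))
    (bG : ∀ v ∈ Set.Icc 0 V, |G v - v ^ 2 / 2| ≤ v ^ 3 / 3)
    (bL : ∀ v ∈ Set.Icc 0 V, |L v - v| ≤ v ^ 2)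
    (bG2 : ∀ v ∈ Set.Icc 0 V, |G2 v - 1| ≤ 2 * v)
    (hw : ∀ v ∈ Set.Icc 0 V, HasDerivAt w (w' v) v) (hw'c : ContinuousOn w' (Set.Icc 0 V))
    (bw : ∀ v ∈ Set.Icc 0 V, |w v| ≤ W) (bw' : ∀ v ∈ Set.Icc 0 V, |w' v| ≤ W) :
    ‖(N : ℂ) * (∫ v in (0:ℝ)..V, Complex.exp (Complex.I * ((N * G v : ℝ) : ℂ)) * (w v : ℂ))
      - (w 0 : ℂ) * (Real.sqrt N : ℂ) * auxF‖
      ≤ 562 * W * (1 + Real.log N + N / (N * V + Real.sqrt N)) := by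
  have hN0 : 0 < N := by linarith
  have m0 : (0:ℝ) ∈ Set.Icc 0 V := ⟨le_rfl, hV0⟩
  have hW0 : 0 ≤ W := (abs_nonneg _).trans (bw 0 m0)
  have bw0 := bw 0 m0
  set r := Real.sqrt N with hr
  have hr0 : 0 < r := Real.sqrt_pos.2 hN0
  have hrr : r * r = N := Real.mul_self_sqrt hN0.le
  have hr1 : 1 ≤ r := Real.one_le_sqrt.2 hN
  have hlog : 0 ≤ Real.log N := Real.log_nonneg hN
  have hnr : ‖(r : ℂ)‖ = r := by rw [Complex.norm_real, Real.norm_of_nonneg hr0.le]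
  have hnN : ‖(N : ℂ)‖ = N := by rw [Complex.norm_real, Real.norm_of_nonneg hN0.le]
  have hnw : ‖((w 0 : ℝ) : ℂ)‖ ≤ W := by rw [Complex.norm_real]; exact bw0
  by_cases hsmall : r * V ≤ 1
  · have t1 : ‖∫ v in (0:ℝ)..V, Complex.exp (Complex.I * ((N * G v : ℝ) : ℂ)) * (w v : ℂ)‖ ≤ W * |V - 0| := by
      apply intervalIntegral.norm_integral_le_of_norm_le_const
      intro v hv
      rw [Set.uIoc_of_le hV0] at hv
      rw [norm_mul, aux_norm_exp, one_mul, Complex.norm_real]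
      exact bw v (Set.Ioc_subset_Icc_self hv)
    rw [sub_zero, abs_of_nonneg hV0] at t1
    have t2 : N / (N * V + r) ≥ r / 2 := by
      rw [ge_iff_le, div_le_div_iff₀ (by norm_num) (by positivity)]
      nlinarith
    have t3 : N * (W * V) ≤ W * r := by
      rw [← hrr]
      have : 0 ≤ W * r := by positivity
      nlinarith
    have t4 : ‖(w 0 : ℂ) * (r : ℂ) * auxF‖ ≤ W * r * 2 := by
      rw [norm_mul, norm_mul, hnr]
      exact mul_le_mul (mul_le_mul_of_nonneg_right hnw hr0.le) auxF_norm (norm_nonneg _) (by positivity)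
    refine (norm_sub_le _ _).trans ?_
    rw [norm_mul, hnN]
    have t5 : N * ‖∫ v in (0:ℝ)..V, Complex.exp (Complex.I * ((N * G v : ℝ) : ℂ)) * (w v : ℂ)‖ ≤ N * (W * V) :=
      mul_le_mul_of_nonneg_left t1 hN0.le
    have t6 : W * (r / 2) ≤ W * (1 + Real.log N + N / (N * V + r)) :=
      mul_le_mul_of_nonneg_left (by linarith) hW0
    have t7 : 0 ≤ W * r := by positivity
    linarith
  · push Not at hsmall
    set c := r⁻¹ with hc
    have hc0 : 0 < c := inv_pos.2 hr0
    have hcr : c * r = 1 := inv_mul_cancel₀ hr0.ne'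
    have hcc : c ^ 2 * N = 1 := by rw [← hrr]; linear_combination (c * r + 1) * hcr
    have hcV : c ≤ V := by
      rw [hc, inv_le_iff_one_le_mul₀ hr0]; linarith
    have hVp : 0 < V := hc0.trans_le hcV
    have hsub : Set.Icc c V ⊆ Set.Icc 0 V := Set.Icc_subset_Icc hc0.le le_rfl
    have hu : Set.uIcc c V = Set.Icc c V := Set.uIcc_of_le hcV
    have bww : ∀ v ∈ Set.Icc 0 V, |w v - w 0| ≤ W * v := by
      intro v hv
      have := (convex_Icc (0:ℝ) V).norm_image_sub_le_of_norm_hasDerivWithin_le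
        (fun x hx => (hw x hx).hasDerivWithinAt) (fun x hx => bw' x hx) m0 hv
      rw [sub_zero, Real.norm_eq_abs, Real.norm_eq_abs, abs_of_nonneg hv.1] at this
      exact this
    have hpos : ∀ v ∈ Set.Icc c V, 0 < v := fun v hv => hc0.trans_le hv.1
    have hle : ∀ v ∈ Set.Icc c V, v ≤ 1 / 2 := fun v hv => hv.2.trans hV
    have hs := fun v hv => aux_sqrt (hpos v hv) (hle v hv) (bG v (hsub hv))
    have ha := fun v hv => aux_alg (hpos v hv) (hle v hv) (bL v (hsub hv)) (hs v hv).1 (bG2 v (hsub hv))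
    have hσ0 : ∀ v ∈ Set.Icc c V, 0 < Real.sqrt (2 * G v) := fun v hv => Real.sqrt_pos.2 (hs v hv).2
    have hσd : ∀ v ∈ Set.Icc c V, HasDerivAt (fun v => Real.sqrt (2 * G v)) (L v / Real.sqrt (2 * G v)) v := by
      intro v hv
      refine (((hG v (hsub hv)).const_mul 2).sqrt (hs v hv).2.ne').congr_deriv ?_
      have := (hσ0 v hv).ne'
      field_simp
    have hGc : ContinuousOn G (Set.Icc 0 V) := fun t ht => (hG t ht).continuousAt.continuousWithinAt
    have hLc : ContinuousOn L (Set.Icc 0 V) := fun t ht => (hL t ht).continuousAt.continuousWithinAt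
    have hwc : ContinuousOn w (Set.Icc 0 V) := fun t ht => (hw t ht).continuousAt.continuousWithinAt
    have hσc : ContinuousOn (fun v => Real.sqrt (2 * G v)) (Set.Icc c V) :=
      fun t ht => (hσd t ht).continuousAt.continuousWithinAt
    have hfc : ContinuousOn (fun v => Complex.exp (Complex.I * ((N * G v : ℝ) : ℂ)) * (w v : ℂ)) (Set.Icc 0 V) := by
      fun_prop
    have hσ'c : ContinuousOn (fun v => L v / Real.sqrt (2 * G v)) (Set.Icc c V) :=
      (hLc.mono hsub).div hσc (fun v hv => (hσ0 v hv).ne')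
    have hgc : ContinuousOn (fun v => Complex.exp (Complex.I * ((N * G v : ℝ) : ℂ)) *
        ((L v / Real.sqrt (2 * G v) : ℝ) : ℂ)) (Set.Icc c V) := by
      have := hGc.mono hsub
      fun_prop
    have hhc : ContinuousOn (fun v => Complex.exp (Complex.I * ((N * G v : ℝ) : ℂ)) *
        ((w v - w 0 * (L v / Real.sqrt (2 * G v)) : ℝ) : ℂ)) (Set.Icc c V) := by
      have := hGc.mono hsub
      have := hwc.mono hsub
      fun_prop
    let e0 : ℝ → ℂ := fun s => Complex.exp (Complex.I * ((N * (s ^ 2 / 2) : ℝ) : ℂ))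
    have he0 : Continuous e0 := by fun_prop
    let E : ℝ → ℂ := fun x => ∫ s in (0:ℝ)..x, e0 s
    -- inner
    have hi0 : IntervalIntegrable (fun v => Complex.exp (Complex.I * ((N * G v : ℝ) : ℂ)) * (w v : ℂ))
        MeasureTheory.volume 0 c := by
      apply ContinuousOn.intervalIntegrable
      rw [Set.uIcc_of_le hc0.le]
      exact hfc.mono (Set.Icc_subset_Icc le_rfl hcV)
    have hi1 : IntervalIntegrable (fun v => Complex.exp (Complex.I * ((N * G v : ℝ) : ℂ)) * (w v : ℂ))
        MeasureTheory.volume c V := by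
      apply ContinuousOn.intervalIntegrable
      rw [hu]
      exact hfc.mono hsub
    have A : ‖(∫ v in (0:ℝ)..c, Complex.exp (Complex.I * ((N * G v : ℝ) : ℂ)) * (w v : ℂ)) - (w 0 : ℂ) * E c‖
        ≤ 2 * W / N := by
      have e1 : (w 0 : ℂ) * E c = ∫ s in (0:ℝ)..c, (w 0 : ℂ) * e0 s := by
        rw [intervalIntegral.integral_const_mul]
      rw [e1, ← intervalIntegral.integral_sub hi0 ((he0.intervalIntegrable _ _).const_mul _)]
      have := intervalIntegral.norm_integral_le_of_norm_le_const (a := 0) (b := c) (C := 2 * W * c)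
        (f := fun v => Complex.exp (Complex.I * ((N * G v : ℝ) : ℂ)) * (w v : ℂ) - (w 0 : ℂ) * e0 v) (by
          intro v hv
          rw [Set.uIoc_of_le hc0.le] at hv
          have hvm : v ∈ Set.Icc 0 V := ⟨hv.1.le, hv.2.trans hcV⟩
          have e : Complex.exp (Complex.I * ((N * G v : ℝ) : ℂ)) * (w v : ℂ) - (w 0 : ℂ) * e0 v
            = Complex.exp (Complex.I * ((N * G v : ℝ) : ℂ)) * ((w v - w 0 : ℝ) : ℂ) +
              (w 0 : ℂ) * (Complex.exp (Complex.I * ((N * G v : ℝ) : ℂ)) - e0 v) := by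
            push_cast; ring
          rw [e]
          refine (norm_add_le _ _).trans ?_
          rw [norm_mul, norm_mul, aux_norm_exp, one_mul, Complex.norm_real, Real.norm_eq_abs]
          have h1 := bww v hvm
          have h2 := aux_exp_diff (N * G v) (N * (v ^ 2 / 2))
          rw [← mul_sub, abs_mul, abs_of_pos hN0] at h2
          have h3 : N * |G v - v ^ 2 / 2| ≤ c := by
            have h4 := bG v hvm
            have h5 : v ^ 3 ≤ c ^ 3 := by
              have := hv.1.le
              have := hv.2
              gcongr
            have h6 : N * c ^ 3 = c := by linear_combination c * hcc
            have h7 : N * |G v - v ^ 2 / 2| ≤ N * (c ^ 3) :=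
              mul_le_mul_of_nonneg_left (by have := pow_pos hc0 3; linarith) hN0.le
            linarith
          have h8 : ‖((w 0 : ℝ) : ℂ)‖ * ‖Complex.exp (Complex.I * ((N * G v : ℝ) : ℂ)) - e0 v‖ ≤ W * c :=
            mul_le_mul hnw (h2.trans h3) (norm_nonneg _) hW0
          have h9 : W * v ≤ W * c := mul_le_mul_of_nonneg_left hv.2 hW0
          linarith)
      refine this.trans (le_of_eq ?_)
      rw [sub_zero, abs_of_pos hc0, eq_div_iff hN0.ne']
      linear_combination 2 * W * hcc
    -- outer
    have O := aux_outer hN0 hc0 hcV hV (w0 := w 0) (fun v hv => hG v (hsub hv)) (fun v hv => hL v (hsub hv))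
      (hG2c.mono hsub) (fun v hv => bG v (hsub hv)) (fun v hv => bL v (hsub hv))
      (fun v hv => bG2 v (hsub hv)) (fun v hv => hw v (hsub hv)) (hw'c.mono hsub)
      (fun v hv => bw' v (hsub hv)) (fun v hv => bww v (hsub hv)) bw0
    have Ed : ∫ v in c..V, Complex.exp (Complex.I * ((N * G v : ℝ) : ℂ)) *
        ((L v / Real.sqrt (2 * G v) : ℝ) : ℂ) = E (Real.sqrt (2 * G V)) - E (Real.sqrt (2 * G c)) := by
      refine intervalIntegral.integral_eq_sub_of_hasDerivAt (f := fun v => E (Real.sqrt (2 * G v)))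
        ?_ (hu ▸ hgc).intervalIntegrable
      intro v hv
      rw [hu] at hv
      have h1 : HasDerivAt E (e0 (Real.sqrt (2 * G v))) (Real.sqrt (2 * G v)) :=
        intervalIntegral.integral_hasDerivAt_right (he0.intervalIntegrable _ _)
          (he0.stronglyMeasurableAtFilter _ _) he0.continuousAt
      have h2 := HasDerivAt.scomp v h1 (hσd v hv)
      refine h2.congr_deriv ?_
      rw [Complex.real_smul, mul_comm]
      simp only [e0]
      rw [Real.sq_sqrt (hs v hv).2.le]
      congr 4
      ring
    have split : ∫ v in c..V, Complex.exp (Complex.I * ((N * G v : ℝ) : ℂ)) * (w v : ℂ) =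
        (∫ v in c..V, Complex.exp (Complex.I * ((N * G v : ℝ) : ℂ)) *
          ((w v - w 0 * (L v / Real.sqrt (2 * G v)) : ℝ) : ℂ)) +
        (w 0 : ℂ) * (E (Real.sqrt (2 * G V)) - E (Real.sqrt (2 * G c))) := by
      rw [← Ed, ← intervalIntegral.integral_const_mul, ← intervalIntegral.integral_add
        (hu ▸ hhc).intervalIntegrable ((hu ▸ hgc).intervalIntegrable.const_mul _)]
      congr 1
      ext v
      push_cast; ring
    have mc : c ∈ Set.Icc c V := ⟨le_rfl, hcV⟩
    have mV : V ∈ Set.Icc c V := ⟨hcV, le_rfl⟩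
    have B1 : ‖E c - E (Real.sqrt (2 * G c))‖ ≤ 1 / N := by
      have h1 : E c - E (Real.sqrt (2 * G c)) = ∫ s in (Real.sqrt (2 * G c))..c, e0 s :=
        intervalIntegral.integral_interval_sub_left (he0.intervalIntegrable _ _) (he0.intervalIntegrable _ _)
      rw [h1]
      have := intervalIntegral.norm_integral_le_of_norm_le_const (a := Real.sqrt (2 * G c)) (b := c) (C := 1)
        (f := e0) (fun s _ => (aux_norm_exp _).le)
      refine this.trans ?_
      rw [abs_sub_comm, one_mul, le_div_iff₀ hN0]
      have := (hs c mc).1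
      nlinarith
    have B2 : ‖E (Real.sqrt (2 * G V)) - (c : ℂ) * auxF‖ ≤ 4 / (N * V) := by
      have hσ := hσ0 V mV
      have h1 : E (Real.sqrt (2 * G V)) = _ := aux_scale hN0
      rw [h1, ← mul_sub, norm_mul, Complex.norm_real, Real.norm_of_nonneg hc0.le]
      have h2 := aux_fresnel (mul_pos hr0 hσ)
      have h3 := (ha V mV).2.2.2.1
      calc _ ≤ c * (2 / (r * Real.sqrt (2 * G V))) := mul_le_mul_of_nonneg_left h2 hc0.le
        _ ≤ c * (2 / (r * (V / 2))) := by gcongr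
        _ = 4 / (N * V) := by rw [hc, ← hrr]; field_simp; norm_num
    have hadd := intervalIntegral.integral_add_adjacent_intervals hi0 hi1
    rw [← hadd, split]
    have hNc : (N : ℂ) * (c : ℂ) = (r : ℂ) := by
      have : N * c = r := by rw [← hrr]; linear_combination r * hcr
      exact_mod_cast this
    rw [← hNc]
    generalize (∫ v in (0:ℝ)..c, Complex.exp (Complex.I * ((N * G v : ℝ) : ℂ)) * (w v : ℂ)) = P at *
    generalize (∫ v in c..V, Complex.exp (Complex.I * ((N * G v : ℝ) : ℂ)) *
          ((w v - w 0 * (L v / Real.sqrt (2 * G v)) : ℝ) : ℂ)) = Q at *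
    have e : (N : ℂ) * (P + (Q + (w 0 : ℂ) * (E (Real.sqrt (2 * G V)) - E (Real.sqrt (2 * G c)))))
        - (w 0 : ℂ) * ((N : ℂ) * (c : ℂ)) * auxF =
        (N : ℂ) * ((P - (w 0 : ℂ) * E c) + Q + ((w 0 : ℂ) * (E c - E (Real.sqrt (2 * G c))) +
          (w 0 : ℂ) * (E (Real.sqrt (2 * G V)) - (c : ℂ) * auxF))) := by ring
    rw [e, norm_mul, hnN]
    have n1 := norm_add_le ((P - (w 0 : ℂ) * E c) + Q) ((w 0 : ℂ) * (E c - E (Real.sqrt (2 * G c))) +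
          (w 0 : ℂ) * (E (Real.sqrt (2 * G V)) - (c : ℂ) * auxF))
    have n2 := norm_add_le (P - (w 0 : ℂ) * E c) Q
    have n3 := norm_add_le ((w 0 : ℂ) * (E c - E (Real.sqrt (2 * G c))))
          ((w 0 : ℂ) * (E (Real.sqrt (2 * G V)) - (c : ℂ) * auxF))
    have n4 : ‖(w 0 : ℂ) * (E c - E (Real.sqrt (2 * G c)))‖ ≤ W * (1 / N) := by
      rw [norm_mul]; exact mul_le_mul hnw B1 (norm_nonneg _) hW0
    have n5 : ‖(w 0 : ℂ) * (E (Real.sqrt (2 * G V)) - (c : ℂ) * auxF)‖ ≤ W * (4 / (N * V)) := by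
      rw [norm_mul]; exact mul_le_mul hnw B2 (norm_nonneg _) hW0
    have hlog2 : Real.log (V / c) ≤ Real.log N := by
      apply Real.log_le_log (by positivity)
      rw [hc, div_inv_eq_mul]
      nlinarith
    have hlast : 4 / V ≤ 8 * (N / (N * V + r)) := by
      rw [← mul_div_assoc, div_le_div_iff₀ hVp (by positivity)]
      have : r ≤ N * V := by rw [← hrr]; nlinarith
      nlinarith
    have tot : N * (2 * W / N + W / N * (20 + 562 * Real.log (V / c)) + (W * (1 / N) + W * (4 / (N * V))))
        = W * (23 + 562 * Real.log (V / c) + 4 / V) := by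
      field_simp; ring
    calc _ ≤ N * (2 * W / N + W / N * (20 + 562 * Real.log (V / c)) + (W * (1 / N) + W * (4 / (N * V)))) := by
          apply mul_le_mul_of_nonneg_left _ hN0.le
          linarith
      _ = W * (23 + 562 * Real.log (V / c) + 4 / V) := tot
      _ ≤ W * (562 * (1 + Real.log N + N / (N * V + r))) := by
          apply mul_le_mul_of_nonneg_left _ hW0
          have : 0 ≤ N / (N * V + r) := by positivity
          linarith
      _ = _ := by ring
theorem aux_log {u : ℝ} (hu : |u| ≤ 1 / 10) :
    |Real.log (1 + u) - u| ≤ |u| ^ 2 ∧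
    |(1 + u) * Real.log (1 + u) - u - u ^ 2 / 2| ≤ |u| ^ 3 / 3 := by
  have h := Real.abs_log_sub_add_sum_range_le (x := -u) (by rw [abs_neg]; linarith) 3
  simp only [Finset.sum_range_succ, Finset.sum_range_zero, abs_neg, sub_neg_eq_add] at h
  norm_num at h
  set l := Real.log (1 + u)
  set y := |u| with hy
  have hy0 : 0 ≤ y := abs_nonneg u
  have hden : y ^ 4 / (1 - y) ≤ 10 / 9 * y ^ 4 := by
    rw [div_le_iff₀ (by linarith)]
    nlinarith [pow_nonneg hy0 4]
  have hr : |l - (u - u ^ 2 / 2 + u ^ 3 / 3)| ≤ 10 / 9 * y ^ 4 := by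
    refine le_trans (le_of_eq ?_) (h.trans hden)
    congr 1; ring
  set r := l - (u - u ^ 2 / 2 + u ^ 3 / 3) with hrdef
  have hu2 : |u ^ 2| = y ^ 2 := abs_pow u 2
  have hu3 : |u ^ 3| = y ^ 3 := abs_pow u 3
  have hu4 : |u ^ 4| = y ^ 4 := abs_pow u 4
  have y3 : y ^ 3 ≤ y ^ 2 / 10 := by nlinarith [pow_nonneg hy0 2]
  have y4 : y ^ 4 ≤ y ^ 3 / 10 := by nlinarith [pow_nonneg hy0 3]
  have y3' := pow_nonneg hy0 3
  have y2' := pow_nonneg hy0 2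
  rw [abs_le] at hr
  constructor
  · have e : l - u = - (u ^ 2 / 2) + u ^ 3 / 3 + r := by rw [hrdef]; ring
    rw [e, abs_le]
    have := abs_le.1 hu2.le
    have := abs_le.1 hu3.le
    constructor <;> linarith
  · have e : (1 + u) * l - u - u ^ 2 / 2 = - (u ^ 3 / 6) + u ^ 4 / 3 + (1 + u) * r := by rw [hrdef]; ring
    have h1 : |(1 + u) * r| ≤ 11 / 10 * (10 / 9 * y ^ 4) := by
      rw [abs_mul]
      apply mul_le_mul _ (abs_le.2 hr) (abs_nonneg _) (by norm_num)
      rw [abs_le] at hu ⊢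
      constructor <;> linarith
    rw [abs_le] at h1
    rw [e, abs_le]
    have := abs_le.1 hu3.le
    have := abs_le.1 hu4.le
    constructor <;> linarith

theorem aux_conc {ε ξ V W : ℝ} (hε : ε = 1 ∨ ε = -1) (hξ : 1 ≤ ξ) (hV0 : 0 ≤ V) (hV : V ≤ 1 / 10)
    {w w' : ℝ → ℝ}
    (hw : ∀ v ∈ Set.Icc 0 V, HasDerivAt w (w' (ξ + ε * ξ * v)) (ξ + ε * ξ * v))
    (hw'c : ContinuousOn (fun v => w' (ξ + ε * ξ * v)) (Set.Icc 0 V))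
    (bw : ∀ v ∈ Set.Icc 0 V, |w (ξ + ε * ξ * v)| ≤ W)
    (bw' : ∀ v ∈ Set.Icc 0 V, |(ξ + ε * ξ * v) * w' (ξ + ε * ξ * v)| ≤ W) :
    ‖(ε : ℂ) * (∫ t in ξ..(ξ + ε * ξ * V),
        Complex.exp (Complex.I * ((t * (Real.log (t / ξ) - 1) : ℝ) : ℂ)) * (w t : ℂ))
      - (w ξ : ℂ) * (Real.sqrt ξ : ℂ) * auxF * Complex.exp (-(Complex.I) * ξ)‖
      ≤ 1124 * W * (1 + Real.log ξ + ξ / (ξ * V + Real.sqrt ξ)) := by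
  have hξ0 : 0 < ξ := by linarith
  have hε2 : ε * ε = 1 := by rcases hε with h | h <;> rw [h] <;> norm_num
  have hεa : |ε| = 1 := by rcases hε with h | h <;> rw [h] <;> norm_num
  have m0 : (0:ℝ) ∈ Set.Icc 0 V := ⟨le_rfl, hV0⟩
  have hW0 : 0 ≤ W := (abs_nonneg _).trans (bw 0 m0)
  have habs : ∀ v ∈ Set.Icc 0 V, |ε * v| = v := fun v hv => by
    rw [abs_mul, hεa, one_mul, abs_of_nonneg hv.1]
  have hab' : ∀ v ∈ Set.Icc 0 V, |ε * v| ≤ 1 / 10 := fun v hv => by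
    rw [habs v hv]; exact hv.2.trans hV
  have h1p : ∀ v ∈ Set.Icc 0 V, 9 / 10 ≤ 1 + ε * v := fun v hv => by
    have := (abs_le.1 (hab' v hv)).1
    linarith
  have hud : ∀ v : ℝ, HasDerivAt (fun v => 1 + ε * v) ε v := fun v => by
    refine (((hasDerivAt_id v).const_mul ε).const_add 1).congr_deriv ?_
    simp
  have hld : ∀ v ∈ Set.Icc 0 V, HasDerivAt (fun v => Real.log (1 + ε * v)) (ε / (1 + ε * v)) v :=
    fun v hv => (hud v).log (by have := h1p v hv; linarith)
  have main := aux_side hξ hV0 (hV.trans (by norm_num)) (W := 2 * W)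
    (G := fun v => (1 + ε * v) * Real.log (1 + ε * v) - ε * v)
    (L := fun v => ε * Real.log (1 + ε * v)) (G2 := fun v => ε * (ε / (1 + ε * v)))
    (w := fun v => w (ξ + ε * ξ * v)) (w' := fun v => w' (ξ + ε * ξ * v) * (ε * ξ))
    (fun v hv => by
      have h0 : 1 + ε * v ≠ 0 := by have := h1p v hv; linarith
      refine (((hud v).mul (hld v hv)).sub ((hasDerivAt_id v).const_mul ε)).congr_deriv ?_
      field_simp; ring)
    (fun v hv => (hld v hv).const_mul ε)
    (by
      apply continuousOn_const.mul
      apply continuousOn_const.div (by fun_prop)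
      intro v hv
      have := h1p v hv; linarith)
    (fun v hv => by
      have := (aux_log (hab' v hv)).2
      rw [habs v hv] at this
      refine le_trans (le_of_eq ?_) this
      congr 1
      linear_combination (v ^ 2 / 2) * hε2)
    (fun v hv => by
      have := (aux_log (hab' v hv)).1
      rw [habs v hv] at this
      refine le_trans (le_of_eq ?_) this
      rw [← one_mul |Real.log (1 + ε * v) - ε * v|, ← hεa, ← abs_mul]
      congr 1
      linear_combination v * hε2)
    (fun v hv => by
      have h0 := h1p v hv
      have e : ε * (ε / (1 + ε * v)) - 1 = - (ε * v) / (1 + ε * v) := by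
        rw [← mul_div_assoc, hε2, eq_div_iff (by linarith), sub_mul, div_mul_cancel₀ _ (by linarith)]
        ring
      rw [e, abs_div, abs_neg, habs v hv, abs_of_pos (by linarith), div_le_iff₀ (by linarith)]
      nlinarith [hv.1])
    (fun v hv => by
      have : HasDerivAt (fun v => ξ + ε * ξ * v) (ε * ξ) v := by
        refine (((hasDerivAt_id v).const_mul (ε * ξ)).const_add ξ).congr_deriv ?_
        simp
      exact (hw v hv).comp v this)
    (hw'c.mul continuousOn_const)
    (fun v hv => (bw v hv).trans (by linarith))
    (fun v hv => by
      have h0 := h1p v hv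
      have h1 := bw' v hv
      have e : ξ + ε * ξ * v = ξ * (1 + ε * v) := by ring
      have e2 : |(ξ + ε * ξ * v) * w' (ξ + ε * ξ * v)| = (1 + ε * v) * |w' (ξ + ε * ξ * v) * (ε * ξ)| := by
        rw [abs_mul, abs_mul, abs_mul, hεa, abs_of_pos hξ0, abs_of_pos (a := ξ + ε * ξ * v) (by rw [e]; positivity)]
        ring
      rw [e2] at h1
      nlinarith [abs_nonneg (w' (ξ + ε * ξ * v) * (ε * ξ))])
  have sub := intervalIntegral.smul_integral_comp_add_mul (a := 0) (b := V)
    (fun t => Complex.exp (Complex.I * ((t * (Real.log (t / ξ) - 1) : ℝ) : ℂ)) * (w t : ℂ)) (ε * ξ) ξ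
  rw [mul_zero, add_zero, Complex.real_smul] at sub
  rw [← sub]
  have hcg : ∫ v in (0:ℝ)..V, Complex.exp (Complex.I * (((ξ + ε * ξ * v) * (Real.log ((ξ + ε * ξ * v) / ξ) - 1) : ℝ) : ℂ)) *
      (w (ξ + ε * ξ * v) : ℂ) = Complex.exp (-(Complex.I) * ξ) *
      ∫ v in (0:ℝ)..V, Complex.exp (Complex.I * ((ξ * ((1 + ε * v) * Real.log (1 + ε * v) - ε * v) : ℝ) : ℂ)) *
      (w (ξ + ε * ξ * v) : ℂ) := by
    rw [← intervalIntegral.integral_const_mul]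
    congr 1
    ext v
    rw [← mul_assoc, ← Complex.exp_add]
    congr 2
    have : (ξ + ε * ξ * v) / ξ = 1 + ε * v := by field_simp
    rw [this]
    push_cast
    ring
  rw [hcg]
  simp only [mul_zero, add_zero] at main
  generalize (∫ v in (0:ℝ)..V, Complex.exp (Complex.I * ((ξ * ((1 + ε * v) * Real.log (1 + ε * v) - ε * v) : ℝ) : ℂ)) *
      (w (ξ + ε * ξ * v) : ℂ)) = J at *
  have hε2' : (ε : ℂ) * ε = 1 := by exact_mod_cast hε2
  have e : (ε : ℂ) * (((ε * ξ : ℝ) : ℂ) * (Complex.exp (-(Complex.I) * ξ) * J)) -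
      (w ξ : ℂ) * (Real.sqrt ξ : ℂ) * auxF * Complex.exp (-(Complex.I) * ξ) =
      Complex.exp (-(Complex.I) * ξ) * ((ξ : ℂ) * J - (w ξ : ℂ) * (Real.sqrt ξ : ℂ) * auxF) := by
    push_cast
    linear_combination (ξ * Complex.exp (-(Complex.I) * ξ) * J) * hε2'
  have hn : ‖Complex.exp (-(Complex.I) * ξ)‖ = 1 := by
    have : -(Complex.I) * (ξ : ℂ) = Complex.I * ((-ξ : ℝ) : ℂ) := by push_cast; ring
    rw [this, aux_norm_exp]
  rw [e, norm_mul, hn, one_mul]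
  refine main.trans (le_of_eq ?_)
  ring

theorem aux_weight (α : ℕ) {T t : ℝ} (hT0 : 0 < T) (hT : 20 ≤ Real.log T) (ht : T ≤ t) :
    HasDerivAt (fun t => ((Real.log (Real.sqrt (t / (2 * Real.pi)))) ^ α)⁻¹)
      (-(α * (Real.log (Real.sqrt (t / (2 * Real.pi)))) ^ (α - 1) * (1 / (2 * t))) /
        ((Real.log (Real.sqrt (t / (2 * Real.pi)))) ^ α) ^ 2) t ∧
    |((Real.log (Real.sqrt (t / (2 * Real.pi)))) ^ α)⁻¹| ≤ (α + 1) * 4 ^ α / (Real.log T) ^ α ∧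
    |t * (-(α * (Real.log (Real.sqrt (t / (2 * Real.pi)))) ^ (α - 1) * (1 / (2 * t))) /
        ((Real.log (Real.sqrt (t / (2 * Real.pi)))) ^ α) ^ 2)| ≤ (α + 1) * 4 ^ α / (Real.log T) ^ α ∧
    Real.log (Real.sqrt (t / (2 * Real.pi))) ≠ 0 ∧
    Real.log (Real.sqrt (t / (2 * Real.pi))) = Real.log (t / (2 * Real.pi)) / 2 := by
  have hpi := Real.pi_pos
  have ht0 : 0 < t := hT0.trans_le ht
  have hq : 0 < t / (2 * Real.pi) := by positivity
  have hl : Real.log (Real.sqrt (t / (2 * Real.pi))) = Real.log (t / (2 * Real.pi)) / 2 := Real.log_sqrt hq.le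
  have hge : Real.log T / 4 ≤ Real.log (Real.sqrt (t / (2 * Real.pi))) := by
    rw [hl, Real.log_div ht0.ne' (by positivity)]
    have h1 := Real.log_le_log hT0 ht
    have h2 := Real.log_le_sub_one_of_pos (x := 2 * Real.pi) (by positivity)
    have h3 := Real.pi_lt_four
    linarith
  set l := Real.log (Real.sqrt (t / (2 * Real.pi))) with hldef
  have hl5 : 5 ≤ l := by linarith
  have hl0 : 0 < l := by linarith
  have hLT : 0 < Real.log T := by linarith
  have hd : HasDerivAt (fun t => Real.log (Real.sqrt (t / (2 * Real.pi)))) (1 / (2 * t)) t := by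
    have := (((hasDerivAt_id t).div_const (2 * Real.pi)).sqrt hq.ne').log (Real.sqrt_pos.2 hq).ne'
    refine this.congr_deriv ?_
    simp only [id]
    have h := Real.sq_sqrt hq.le
    rw [div_div, mul_assoc 2, ← sq, h]
    field_simp
  have hb : (l ^ α)⁻¹ ≤ 4 ^ α / (Real.log T) ^ α := by
    rw [← div_pow, ← inv_pow]
    apply pow_le_pow_left₀ (by positivity)
    rw [inv_le_comm₀ hl0 (by positivity), inv_div]
    exact hge
  have hK : 0 ≤ (4:ℝ) ^ α / (Real.log T) ^ α := by positivity
  have hα : (0:ℝ) ≤ α := Nat.cast_nonneg α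
  refine ⟨(hd.pow α).inv (pow_ne_zero _ hl0.ne'), ?_, ?_, hl0.ne', hl⟩
  · rw [abs_of_pos (by positivity), mul_div_assoc]
    nlinarith
  · have e : |t * (-(α * l ^ (α - 1) * (1 / (2 * t))) / (l ^ α) ^ 2)| = α * (l ^ α)⁻¹ * (l ^ (α - 1) / (2 * l ^ α)) := by
      have : t * (-(α * l ^ (α - 1) * (1 / (2 * t))) / (l ^ α) ^ 2) = - (α * (l ^ α)⁻¹ * (l ^ (α - 1) / (2 * l ^ α))) := by
        field_simp
      rw [this, abs_neg, abs_of_nonneg (by positivity)]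
    rw [e, mul_div_assoc]
    have h1 : l ^ (α - 1) / (2 * l ^ α) ≤ 1 := by
      rw [div_le_one (by positivity)]
      have : l ^ (α - 1) ≤ l ^ α := pow_le_pow_right₀ (by linarith) (by omega)
      have : 0 < l ^ α := by positivity
      linarith
    calc _ ≤ α * (4 ^ α / (Real.log T) ^ α) * 1 := by gcongr
      _ ≤ _ := by nlinarith
theorem aux_weight_cont (α : ℕ) {T : ℝ} (hT0 : 0 < T) (hT : 20 ≤ Real.log T) :
    ContinuousOn (fun t : ℝ => (-(α * (Real.log (Real.sqrt (t / (2 * Real.pi)))) ^ (α - 1) * (1 / (2 * t))) /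
        ((Real.log (Real.sqrt (t / (2 * Real.pi)))) ^ α) ^ 2)) (Set.Ici T) := by
  have hpi := Real.pi_pos
  have hpos : ∀ t ∈ Set.Ici T, 0 < t := fun t ht => hT0.trans_le ht
  have hl : ContinuousOn (fun t : ℝ => Real.log (Real.sqrt (t / (2 * Real.pi)))) (Set.Ici T) := by
    apply ContinuousOn.log (by fun_prop)
    intro t ht
    have := hpos t ht
    exact (Real.sqrt_pos.2 (by positivity)).ne'
  refine ContinuousOn.div (ContinuousOn.neg ((continuousOn_const.mul (hl.pow _)).mul ?_)) ((hl.pow _).pow 2) ?_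
  · apply continuousOn_const.div (by fun_prop)
    intro t ht
    have := hpos t ht
    positivity
  · intro t ht
    exact pow_ne_zero _ (pow_ne_zero _ (aux_weight α hT0 hT ht).2.2.2.1)

theorem aux_log_ge {x y : ℝ} (hx : 0 < x) (hy : 0 < y) : (x - y) / x ≤ Real.log (x / y) := by
  have := Real.one_sub_inv_le_log_of_pos (x := x / y) (by positivity)
  rw [inv_div] at this
  have e : (x - y) / x = 1 - y / x := by field_simp
  rw [e]; exact this

theorem aux_nonstat {T B ξ W : ℝ} (hT : 1 ≤ T) (hB : T + Real.sqrt T ≤ B) (hB2 : B ≤ 2 * T)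
    (hξ : 0 < ξ) {w w' : ℝ → ℝ}
    (hw : ∀ t ∈ Set.Icc T B, HasDerivAt w (w' t) t) (hw' : ContinuousOn w' (Set.Icc T B))
    (hW : ∀ t ∈ Set.Icc T B, |w t| ≤ W) (hW' : ∀ t ∈ Set.Icc T B, |t * w' t| ≤ W)
    (h : ξ ≤ T ∨ B ≤ ξ) :
    ‖∫ t in T..B, Complex.exp (Complex.I * ((t * (Real.log (t / ξ) - 1) : ℝ) : ℂ)) * (w t : ℂ)‖
      ≤ 22 * W * (1 + T / (|T - ξ| + Real.sqrt T) + B / (|B - ξ| + Real.sqrt B)) := by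
  have hT0 : 0 < T := by linarith
  set r := Real.sqrt T with hr
  have hr0 : 0 < r := Real.sqrt_pos.2 hT0
  have hrr : r * r = T := Real.mul_self_sqrt hT0.le
  have hr1 : 1 ≤ r := Real.one_le_sqrt.2 hT
  have hTB : T ≤ B := by linarith
  have hB0 : 0 < B := by linarith
  set ρ := Real.sqrt B with hρ
  have hρ0 : 0 < ρ := Real.sqrt_pos.2 hB0
  have hρρ : ρ * ρ = B := Real.mul_self_sqrt hB0.le
  have hrρ : r ≤ ρ := Real.sqrt_le_sqrt hTB
  have hW0 : 0 ≤ W := (abs_nonneg _).trans (hW T ⟨le_rfl, hTB⟩)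
  set X1 := T / (|T - ξ| + r) with hX1
  set X2 := B / (|B - ξ| + ρ) with hX2
  have hX1p : 0 ≤ X1 := by positivity
  have hX2p : 0 ≤ X2 := by positivity
  have hwc : ContinuousOn w (Set.Icc T B) := fun t ht => (hw t ht).continuousAt.continuousWithinAt
  let f : ℝ → ℂ := fun t => Complex.exp (Complex.I * ((t * (Real.log (t / ξ) - 1) : ℝ) : ℂ)) * (w t : ℂ)
  have hlc : ContinuousOn (fun t => Real.log (t / ξ)) (Set.Icc T B) := by
    apply ContinuousOn.log (by fun_prop)
    intro t ht
    have : 0 < t := hT0.trans_le ht.1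
    positivity
  have hfc : ContinuousOn f (Set.Icc T B) := by
    simp only [f]
    fun_prop
  have hfi : ∀ a b, T ≤ a → a ≤ b → b ≤ B → IntervalIntegrable f MeasureTheory.volume a b := by
    intro a b h1 h2 h3
    apply ContinuousOn.intervalIntegrable
    rw [Set.uIcc_of_le h2]
    exact hfc.mono (Set.Icc_subset_Icc h1 h3)
  have triv : ∀ a b, T ≤ a → a ≤ b → b ≤ B → ‖∫ t in a..b, f t‖ ≤ W * (b - a) := by
    intro a b h1 h2 h3
    have := intervalIntegral.norm_integral_le_of_norm_le_const (a := a) (b := b) (C := W) (f := f) (by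
      intro t ht
      rw [Set.uIoc_of_le h2] at ht
      simp only [f]
      rw [norm_mul, aux_norm_exp, one_mul, Complex.norm_real]
      exact hW t ⟨h1.trans ht.1.le, ht.2.trans h3⟩)
    rwa [abs_of_nonneg (by linarith)] at this
  have fd : ∀ a b δ, T ≤ a → a ≤ b → b ≤ B → 0 < δ → (∀ t ∈ Set.Icc a b, δ ≤ |Real.log (t / ξ)|) →
      ‖∫ t in a..b, f t‖ ≤ 5 * W / δ := by
    intro a b δ h1 h2 h3 h4 h5
    have hs : Set.Icc a b ⊆ Set.Icc T B := Set.Icc_subset_Icc h1 h3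
    exact aux_fd (by linarith) h2 (by linarith) hξ h4 h5 (fun t ht => hw t (hs ht)) (hw'.mono hs)
      (fun t ht => hW t (hs ht)) (fun t ht => hW' t (hs ht))
  change ‖∫ t in T..B, f t‖ ≤ _
  rcases h with h | h
  · have hd : |T - ξ| = T - ξ := abs_of_nonneg (by linarith)
    have lg : ∀ a b, T ≤ a → ξ < a → ∀ t ∈ Set.Icc a b, (a - ξ) / a ≤ |Real.log (t / ξ)| := by
      intro a b h1 h2 t ht
      have ha : 0 < a := by linarith
      have h3 := aux_log_ge ha hξ
      have h4 : Real.log (a / ξ) ≤ Real.log (t / ξ) :=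
        Real.log_le_log (by positivity) (div_le_div_of_nonneg_right ht.1 hξ.le)
      exact (h3.trans h4).trans (le_abs_self _)
    by_cases hc : r ≤ T - ξ
    · have hp : 0 < T - ξ := by linarith
      have := fd T B ((T - ξ) / T) le_rfl hTB le_rfl (by positivity) (lg T B le_rfl (by linarith))
      refine this.trans ?_
      have e : 5 * W / ((T - ξ) / T) = W * (5 * (T / (T - ξ))) := by field_simp
      have e2 : T / (T - ξ) ≤ 2 * X1 := by
        rw [hX1, hd, ← mul_div_assoc, div_le_div_iff₀ hp (by positivity)]
        nlinarith
      rw [e, mul_comm 22 W, mul_assoc]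
      apply mul_le_mul_of_nonneg_left _ hW0
      linarith
    · push Not at hc
      have hx : r / 2 ≤ X1 := by
        rw [hX1, hd, div_le_div_iff₀ (by norm_num) (by linarith)]
        nlinarith
      have h1 := triv T (T + r) le_rfl (by linarith) hB
      have h2 := fd (T + r) B ((T + r - ξ) / (T + r)) (by linarith) hB le_rfl
        (div_pos (by linarith) (by linarith)) (lg _ _ (by linarith) (by linarith))
      have h3 : 5 * W / ((T + r - ξ) / (T + r)) ≤ W * (10 * r) := by
        have : (T + r) / (T + r - ξ) ≤ 2 * r := by
          rw [div_le_iff₀ (by linarith)]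
          nlinarith
        calc _ = W * (5 * ((T + r) / (T + r - ξ))) := by
              have : T + r - ξ ≠ 0 := by linarith
              field_simp
          _ ≤ _ := mul_le_mul_of_nonneg_left (by linarith) hW0
      rw [← intervalIntegral.integral_add_adjacent_intervals (hfi T (T + r) le_rfl (by linarith) hB)
        (hfi (T + r) B (by linarith) hB le_rfl)]
      refine (norm_add_le _ _).trans ?_
      have h4 : W * (11 * r) ≤ W * (22 * (1 + X1 + X2)) := mul_le_mul_of_nonneg_left (by linarith) hW0
      have h5 : W * (T + r - T) = W * r := by ring
      linarith
  · have hd : |B - ξ| = ξ - B := by rw [abs_sub_comm]; exact abs_of_nonneg (by linarith)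
    have lg : ∀ b a, 0 < a → b < ξ → ∀ t ∈ Set.Icc a b, (ξ - b) / ξ ≤ |Real.log (t / ξ)| := by
      intro b a ha h2 t ht
      have ht0 : 0 < t := ha.trans_le ht.1
      have hb : 0 < b := ht0.trans_le ht.2
      have h3 := aux_log_ge hξ hb
      have h4 : Real.log (ξ / b) ≤ Real.log (ξ / t) :=
        Real.log_le_log (by positivity) (div_le_div_of_nonneg_left hξ.le ht0 ht.2)
      have h5 : Real.log (t / ξ) = - Real.log (ξ / t) := by rw [← Real.log_inv, inv_div]
      rw [h5, abs_neg]
      exact (h3.trans h4).trans (le_abs_self _)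
    by_cases hc : ρ ≤ ξ - B
    · have hp : 0 < ξ - B := by linarith
      have := fd T B ((ξ - B) / ξ) le_rfl hTB le_rfl (by positivity) (lg B T hT0 (by linarith))
      refine this.trans ?_
      have e : 5 * W / ((ξ - B) / ξ) = W * (5 * (1 + B / (ξ - B))) := by field_simp; ring
      have e2 : B / (ξ - B) ≤ 2 * X2 := by
        rw [hX2, hd, ← mul_div_assoc, div_le_div_iff₀ hp (by positivity)]
        nlinarith
      rw [e, mul_comm 22 W, mul_assoc]
      apply mul_le_mul_of_nonneg_left _ hW0
      linarith
    · push Not at hc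
      have hx : r / 2 ≤ X2 := by
        rw [hX2, hd, div_le_div_iff₀ (by norm_num) (by linarith)]
        nlinarith
      have h1 := triv (B - r) B (by linarith) (by linarith) le_rfl
      have h2 := fd T (B - r) ((ξ - (B - r)) / ξ) le_rfl (by linarith) (by linarith)
        (div_pos (by linarith) (by linarith)) (lg _ _ hT0 (by linarith))
      have h3 : 5 * W / ((ξ - (B - r)) / ξ) ≤ W * (10 * r) := by
        have : ξ / (ξ - (B - r)) ≤ 2 * r := by
          rw [div_le_iff₀ (by linarith)]
          nlinarith
        calc _ = W * (5 * (ξ / (ξ - (B - r)))) := by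
              have : ξ - (B - r) ≠ 0 := by linarith
              field_simp
          _ ≤ _ := mul_le_mul_of_nonneg_left (by linarith) hW0
      rw [← intervalIntegral.integral_add_adjacent_intervals (hfi T (B - r) le_rfl (by linarith) (by linarith))
        (hfi (B - r) B (by linarith) (by linarith) le_rfl)]
      refine (norm_add_le _ _).trans ?_
      have h4 : W * (11 * r) ≤ W * (22 * (1 + X1 + X2)) := mul_le_mul_of_nonneg_left (by linarith) hW0
      have h5 : W * (B - (B - r)) = W * r := by ring
      linarith

theorem aux_stat {T B ξ W : ℝ} (hT : 2 ≤ T) (hlT : 20 ≤ Real.log T) (hB : T + Real.sqrt T ≤ B)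
    (hB2 : B - T ≤ T / Real.log T) (hTξ : T ≤ ξ) (hξB : ξ ≤ B) {w w' : ℝ → ℝ}
    (hw : ∀ t ∈ Set.Icc T B, HasDerivAt w (w' t) t) (hw' : ContinuousOn w' (Set.Icc T B))
    (hW : ∀ t ∈ Set.Icc T B, |w t| ≤ W) (hW' : ∀ t ∈ Set.Icc T B, |t * w' t| ≤ W) :
    ‖(∫ t in T..B, Complex.exp (Complex.I * ((t * (Real.log (t / ξ) - 1) : ℝ) : ℂ)) * (w t : ℂ))
      - 2 * ((w ξ : ℂ) * (Real.sqrt ξ : ℂ) * auxF * Complex.exp (-(Complex.I) * ξ))‖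
      ≤ 11240 * W * (1 + T / (|T - ξ| + Real.sqrt T) + B / (|B - ξ| + Real.sqrt B)) := by
  have hT0 : 0 < T := by linarith
  have hTB : T ≤ B := hTξ.trans hξB
  have hξ0 : 0 < ξ := by linarith
  have hξ1 : 1 ≤ ξ := by linarith
  have hlog0 : 0 < Real.log T := by linarith
  have hB10 : B - T ≤ T / 20 := hB2.trans (div_le_div_of_nonneg_left hT0.le (by norm_num) hlT)
  have hW0 : 0 ≤ W := (abs_nonneg _).trans (hW T ⟨le_rfl, hTB⟩)
  have hwc : ContinuousOn w (Set.Icc T B) := fun t ht => (hw t ht).continuousAt.continuousWithinAt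
  let f : ℝ → ℂ := fun t => Complex.exp (Complex.I * ((t * (Real.log (t / ξ) - 1) : ℝ) : ℂ)) * (w t : ℂ)
  have hlc : ContinuousOn (fun t => Real.log (t / ξ)) (Set.Icc T B) := by
    apply ContinuousOn.log (by fun_prop)
    intro t ht
    have : 0 < t := hT0.trans_le ht.1
    positivity
  have hfc : ContinuousOn f (Set.Icc T B) := by
    simp only [f]
    fun_prop
  have hfi : ∀ a b, T ≤ a → a ≤ b → b ≤ B → IntervalIntegrable f MeasureTheory.volume a b := by
    intro a b h1 h2 h3
    apply ContinuousOn.intervalIntegrable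
    rw [Set.uIcc_of_le h2]
    exact hfc.mono (Set.Icc_subset_Icc h1 h3)
  have m1 : ∀ v ∈ Set.Icc 0 ((B - ξ) / ξ), ξ + 1 * ξ * v ∈ Set.Icc T B := by
    intro v hv
    have h1 := hv.2
    rw [le_div_iff₀ hξ0] at h1
    have := mul_nonneg hξ0.le hv.1
    constructor <;> linarith
  have m2 : ∀ v ∈ Set.Icc 0 ((ξ - T) / ξ), ξ + (-1) * ξ * v ∈ Set.Icc T B := by
    intro v hv
    have h1 := hv.2
    rw [le_div_iff₀ hξ0] at h1
    have := mul_nonneg hξ0.le hv.1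
    constructor <;> linarith
  have s1 := aux_conc (ε := 1) (W := W) (Or.inl rfl) hξ1 (V := (B - ξ) / ξ) (div_nonneg (by linarith) hξ0.le)
    (by rw [div_le_iff₀ hξ0]; linarith) (fun v hv => hw _ (m1 v hv))
    (hw'.comp (by fun_prop) m1) (fun v hv => hW _ (m1 v hv)) (fun v hv => hW' _ (m1 v hv))
  have s2 := aux_conc (ε := -1) (W := W) (Or.inr rfl) hξ1 (V := (ξ - T) / ξ) (div_nonneg (by linarith) hξ0.le)
    (by rw [div_le_iff₀ hξ0]; linarith) (fun v hv => hw _ (m2 v hv))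
    (hw'.comp (by fun_prop) m2) (fun v hv => hW _ (m2 v hv)) (fun v hv => hW' _ (m2 v hv))
  have e1 : ξ + 1 * ξ * ((B - ξ) / ξ) = B := by field_simp; ring
  have e2 : ξ + (-1) * ξ * ((ξ - T) / ξ) = T := by field_simp; ring
  rw [e1, mul_div_cancel₀ _ hξ0.ne'] at s1
  rw [e2, mul_div_cancel₀ _ hξ0.ne'] at s2
  change ‖((1:ℝ):ℂ) * (∫ t in ξ..B, f t) - _‖ ≤ _ at s1
  change ‖((-1:ℝ):ℂ) * (∫ t in ξ..T, f t) - _‖ ≤ _ at s2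
  change ‖(∫ t in T..B, f t) - _‖ ≤ _
  rw [intervalIntegral.integral_symm] at s2
  rw [← intervalIntegral.integral_add_adjacent_intervals (hfi T ξ le_rfl hTξ hξB) (hfi ξ B hTξ hξB le_rfl)]
  generalize (w ξ : ℂ) * (Real.sqrt ξ : ℂ) * auxF * Complex.exp (-(Complex.I) * ξ) = M at *
  generalize (∫ t in T..ξ, f t) = P at *
  generalize (∫ t in ξ..B, f t) = Q at *
  have e : P + Q - 2 * M = (((-1:ℝ):ℂ) * (-P) - M) + (((1:ℝ):ℂ) * Q - M) := by push_cast; ring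
  rw [e]
  refine (norm_add_le _ _).trans ((add_le_add s2 s1).trans ?_)
  rw [abs_sub_comm T ξ, abs_of_nonneg (a := ξ - T) (by linarith), abs_of_nonneg (a := B - ξ) (by linarith)]
  set r := Real.sqrt T with hr
  set q := Real.sqrt ξ with hq
  set ρ := Real.sqrt B with hρ
  have hr0 : 0 < r := Real.sqrt_pos.2 hT0
  have hq0 : 0 < q := Real.sqrt_pos.2 hξ0
  have hρ0 : 0 < ρ := Real.sqrt_pos.2 (by linarith)
  have hrq : r ≤ q := Real.sqrt_le_sqrt hTξ
  have hqρ : q ≤ ρ := Real.sqrt_le_sqrt hξB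
  have hqq : q * q = ξ := Real.mul_self_sqrt hξ0.le
  have hρρ : ρ * ρ = B := Real.mul_self_sqrt (by linarith)
  have i1 : ξ / (ξ - T + q) ≤ 2 * (T / (ξ - T + r)) := by
    rw [← mul_div_assoc]
    exact div_le_div₀ (by linarith) (by linarith) (by linarith) (by linarith)
  have i2 : ξ / (B - ξ + q) ≤ B / (B - ξ + ρ) := by
    rw [div_le_div_iff₀ (by linarith) (by linarith)]
    have h1 : ξ * (B - ξ) ≤ B * (B - ξ) := mul_le_mul_of_nonneg_right hξB (by linarith)
    have h2 : ξ * ρ ≤ B * q := by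
      rw [← hqq, ← hρρ]
      have : q * ρ * q ≤ q * ρ * ρ := mul_le_mul_of_nonneg_left hqρ (by positivity)
      linarith
    linarith
  have i3 : Real.log ξ ≤ 2 * Real.log T := by
    have : Real.log ξ ≤ Real.log (T ^ 2) := Real.log_le_log hξ0 (by nlinarith)
    rw [Real.log_pow] at this
    exact_mod_cast this
  have i4 : Real.log T ≤ 2 * (T / (ξ - T + r)) := by
    rw [← mul_div_assoc, le_div_iff₀ (by linarith)]
    rw [le_div_iff₀ hlog0] at hB2
    have h1 : Real.log T * (ξ - T + r) ≤ Real.log T * (2 * (B - T)) :=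
      mul_le_mul_of_nonneg_left (by linarith) hlog0.le
    linarith
  have hX : 0 ≤ B / (B - ξ + ρ) := div_nonneg (by linarith) (by linarith)
  have : W * (1 + Real.log ξ + ξ / (ξ - T + q) + (1 + Real.log ξ + ξ / (B - ξ + q)))
      ≤ W * (10 * (1 + T / (ξ - T + r) + B / (B - ξ + ρ))) :=
    mul_le_mul_of_nonneg_left (by linarith) hW0
  linarith



/-- **Lemma 2.2 (exponential integral).** Let `ξ > 0`, `α ≥ 0` an integer, and
`√T ≤ H ≤ T/log T`. Set `I(ξ,α) = ∫_T^{T+H} (t/(eξ))^{it} dt/(log τ)^α` with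
`τ = √(t/2π)` and `(t/(eξ))^{it} = exp(it(log(t/ξ) − 1))`. Then
`I(ξ,α) = 2^α e^{πi/4} √(2πξ) e^{−iξ} (log(ξ/2π))^{−α} + O(R(ξ)(log T)^{−α})` if
`T ≤ ξ ≤ T+H`, and `I(ξ,α) = O((log T)^{−α} R(ξ))` if `ξ ≤ T` or `ξ ≥ T+H`, where
`R(ξ) = O(1) + O(T/(|T−ξ|+√T)) + O((T+H)/(|T+H−ξ|+√(T+H)))`. -/
theorem exponential_integral_asymptotic (α : ℕ) :
    ∃ C : ℝ, 0 < C ∧ ∀ᶠ T : ℝ in atTop, ∀ H ξ : ℝ,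
      Real.sqrt T ≤ H → H ≤ T / Real.log T → 0 < ξ →
      ((T ≤ ξ → ξ ≤ T + H →
        ‖(∫ t in T..(T + H),
              Complex.exp (Complex.I * (t : ℂ) * ((Real.log (t / ξ) - 1 : ℝ) : ℂ)) /
                (((Real.log (Real.sqrt (t / (2 * Real.pi)))) ^ α : ℝ) : ℂ))
            - (2 : ℂ) ^ α * Complex.exp ((Real.pi : ℂ) * Complex.I / 4) *
                ((Real.sqrt (2 * Real.pi * ξ) : ℝ) : ℂ) * Complex.exp (-(Complex.I) * ξ) *
                ((((Real.log (ξ / (2 * Real.pi))) ^ α : ℝ) : ℂ))⁻¹‖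
          ≤ C * (1 + T / (|T - ξ| + Real.sqrt T)
                  + (T + H) / (|T + H - ξ| + Real.sqrt (T + H))) / (Real.log T) ^ α) ∧
      (ξ ≤ T ∨ T + H ≤ ξ →
        ‖(∫ t in T..(T + H),
              Complex.exp (Complex.I * (t : ℂ) * ((Real.log (t / ξ) - 1 : ℝ) : ℂ)) /
                (((Real.log (Real.sqrt (t / (2 * Real.pi)))) ^ α : ℝ) : ℂ))‖
          ≤ C * (1 + T / (|T - ξ| + Real.sqrt T)
                  + (T + H) / (|T + H - ξ| + Real.sqrt (T + H))) / (Real.log T) ^ α)) := by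
  have hα : (0:ℝ) ≤ α := Nat.cast_nonneg α
  refine ⟨11240 * ((α + 1) * 4 ^ α), by positivity, ?_⟩
  filter_upwards [eventually_ge_atTop 2, Real.tendsto_log_atTop.eventually_ge_atTop 20] with T hT hlT
  intro H ξ hH1 hH2 hξ
  have hT0 : 0 < T := by linarith
  have hlog0 : 0 < Real.log T := by linarith
  have hsub : Set.Icc T (T + H) ⊆ Set.Ici T := Set.Icc_subset_Ici_self
  have hw := fun t (ht : t ∈ Set.Icc T (T + H)) => (aux_weight α hT0 hlT (hsub ht)).1
  have hb := fun t (ht : t ∈ Set.Icc T (T + H)) => (aux_weight α hT0 hlT (hsub ht)).2.1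
  have hb' := fun t (ht : t ∈ Set.Icc T (T + H)) => (aux_weight α hT0 hlT (hsub ht)).2.2.1
  have hwc := (aux_weight_cont α hT0 hlT).mono hsub
  have hint : (∫ t in T..(T + H),
      Complex.exp (Complex.I * (t : ℂ) * ((Real.log (t / ξ) - 1 : ℝ) : ℂ)) /
        (((Real.log (Real.sqrt (t / (2 * Real.pi)))) ^ α : ℝ) : ℂ)) =
      ∫ t in T..(T + H), Complex.exp (Complex.I * ((t * (Real.log (t / ξ) - 1) : ℝ) : ℂ)) *
        ((((Real.log (Real.sqrt (t / (2 * Real.pi)))) ^ α)⁻¹ : ℝ) : ℂ) := by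
    congr 1
    ext t
    rw [div_eq_mul_inv, Complex.ofReal_inv, Complex.ofReal_mul, mul_assoc]
  rw [hint]
  have hB : T + Real.sqrt T ≤ T + H := by linarith
  have hBT : T + H - T ≤ T / Real.log T := by linarith
  have hH3 : H ≤ T := hH2.trans (div_le_self hT0.le (by linarith))
  refine ⟨fun h1 h2 => ?_, fun h => ?_⟩
  · have main := aux_stat hT hlT hB hBT h1 h2 hw hwc hb hb'
    have e : 2 * (((((Real.log (Real.sqrt (ξ / (2 * Real.pi)))) ^ α)⁻¹ : ℝ) : ℂ) * (Real.sqrt ξ : ℂ) * auxF *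
        Complex.exp (-(Complex.I) * ξ)) =
        (2 : ℂ) ^ α * Complex.exp ((Real.pi : ℂ) * Complex.I / 4) *
                ((Real.sqrt (2 * Real.pi * ξ) : ℝ) : ℂ) * Complex.exp (-(Complex.I) * ξ) *
                ((((Real.log (ξ / (2 * Real.pi))) ^ α : ℝ) : ℂ))⁻¹ := by
      rw [(aux_weight α hT0 hlT h1).2.2.2.2, Real.sqrt_mul (by positivity), auxF, div_pow, inv_div]
      push_cast
      ring
    rw [e] at main
    refine main.trans (le_of_eq ?_)
    ring
  · have main := aux_nonstat (by linarith) hB (by linarith) hξ hw hwc hb hb' h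
    refine main.trans ?_
    set X := 1 + T / (|T - ξ| + Real.sqrt T) + (T + H) / (|T + H - ξ| + Real.sqrt (T + H))
    have hX : 0 ≤ X := by
      have : 0 ≤ H := (Real.sqrt_nonneg _).trans hH1
      positivity
    have e : 11240 * ((α + 1) * 4 ^ α) * X / (Real.log T) ^ α = 11240 * ((α + 1) * 4 ^ α / (Real.log T) ^ α) * X := by
      ring
    rw [e]
    gcongr
    norm_num
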